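/- Let S = {(0,4),(0,5),(0,6),(1,2),(1,3),(1,4),(1,5),(1,6),(2,1),(2,2),(2,3),(2,5),(2,6),(3,0),(3,2),(3,4),(3,6),(4,2),(4,3),(4,4),(4,5),(5,1),(5,5),(6,2),(6,3)} ⊆ ℕ×ℕ. The generalised toric code C_S over the field with 8 elements has minimum distance exactly 16: every nonzero codeword of C_S has Hamming weight at least 16, and some codeword of C_S has Hamming weight exactly 16. -/

import Mathlib

/-- `F8` is the finite field with 8 elements, `GF(2,3)`. -/
abbrev F8 : Type := GaloisField 2 3

/-- The evaluation vector of an exponent pair `(a, b)`: the function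
`F8ˣ × F8ˣ → F8` sending `(x, y)` to `x ^ a * y ^ b`. -/
noncomputable def evalVec (ab : ℕ × ℕ) : F8ˣ × F8ˣ → F8 :=
  fun xy => (xy.1 : F8) ^ ab.1 * (xy.2 : F8) ^ ab.2

/-- The Hamming weight of a vector `c : F8ˣ × F8ˣ → F8`: the number of
coordinates at which `c` is nonzero. -/
noncomputable def hammingWeight (c : F8ˣ × F8ˣ → F8) : ℕ :=
  Nat.card {p : F8ˣ × F8ˣ // c p ≠ 0}

/-- The set of exponent vectors. -/
def S : Set (ℕ × ℕ) := {(0,4),(0,5),(0,6),(1,2),(1,3),(1,4),(1,5),(1,6),(2,1),(2,2),(2,3),(2,5),(2,6),(3,0),(3,2),(3,4),(3,6),(4,2),(4,3),(4,4),(4,5),(5,1),(5,5),(6,2),(6,3)}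

/-! ### Bit-level search engine -/

/-- `𝔽₂`-linear combination of the words `cs` selected by the bits of `x`. -/
noncomputable def lin (cs : List ℕ) : ℕ → ℕ :=
  @List.rec ℕ (fun _ => ℕ → ℕ) (fun _ => 0)
    (fun c _ ih x => Nat.xor (Nat.mul c (Nat.mod x 2)) (ih (Nat.div x 2))) cs

/-- strict evaluation of a natural number argument -/
noncomputable def force {α : Type} (x : ℕ) (f : ℕ → α) : α :=
  @Nat.rec (fun _ => α) (f (nat_lit 0)) (fun n _ => f (Nat.succ n)) x

/-- basis words of position `i` (one lane) -/
def basis : ℕ → List ℕ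
  | 0 => [5270497050189140553, 3952874358372377746, 7905745575284459812]
  | 1 => [4553608048734214645, 7708528660085679993, 8335124248952556650]
  | 2 => [7291158016466001111, 8704837033797660581, 6310092586503195609]
  | 3 => [9012607977486424766, 6838232148545741615, 1990462354625610957]
  | 4 => [5988344760662463843, 1510102911378434142, 3007178216180074167]
  | 5 => [1674594441718732716, 3236290129565199819, 5731522562314587990]
  | _ => [3102677731902955290, 4816522116107578100, 3865564122561823675]

/-- replicate a word to six lanes of 63 bits -/
def rep (x : ℕ) : ℕ := Nat.mul x 
  66749594872528440082081433895130765796092340603611728397238968555678094600998977643164936962049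

/-- basis words of position `i` -/
def basisR (i : ℕ) : List ℕ := (basis i).map rep

inductive Tr where
  | leaf (l : List (ℕ × ℕ)) : Tr
  | node (bit : ℕ) (a b : Tr) : Tr
  | zero (l : List (ℕ × ℕ)) : Tr

/-- all words supported on the given positions with weight at most `b` -/
noncomputable def ws : List ℕ → ℕ → List (ℕ × ℕ)
  | [], _ => [(0, 0)]
  | _ :: _, 0 => [(0, 0)]
  | i :: is, b + 1 => ws is (b + 1) ++
      [1, 2, 3, 4, 5, 6, 7].flatMap (fun s => (ws is b).map
        (fun p => (Nat.xor (lin (basisR i) s) p.1, Nat.succ p.2)))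

/-- fully evaluate a list, in reverse -/
noncomputable def forceL {α : Type} (l : List (ℕ × ℕ)) (k : List (ℕ × ℕ) → α) : List (ℕ × ℕ) → α :=
  @List.rec (ℕ × ℕ) (fun _ => List (ℕ × ℕ) → α) k
    (fun p _ ih acc => force p.1 (fun x => force p.2 (fun w => ih ((x, w) :: acc)))) l

/-- case distinction on whether a number vanishes -/
noncomputable def pick {α : Type} (x y : α) (n : ℕ) : α := @Nat.rec (fun _ => α) x (fun _ _ => y) n

/-- split a list according to a bit -/
noncomputable def splitK {α : Type} (bit : ℕ) (l : List (ℕ × ℕ))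
    (k : List (ℕ × ℕ) → List (ℕ × ℕ) → α) : List (ℕ × ℕ) → List (ℕ × ℕ) → α :=
  @List.rec (ℕ × ℕ) (fun _ => List (ℕ × ℕ) → List (ℕ × ℕ) → α) k
    (fun p _ ih a b => pick (ih (p :: a) b) (ih a (p :: b)) (Nat.land p.1 bit)) l

/-- build the trie on `n` bits, starting with `bit` -/
noncomputable def buildK {α : Type} (n : ℕ) : ℕ → List (ℕ × ℕ) → (Tr → α) → α :=
  @Nat.rec (fun _ => ℕ → List (ℕ × ℕ) → (Tr → α) → α)
    (fun _ l k => k (Tr.leaf l))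
    (fun _ ih bit l k => @List.rec (ℕ × ℕ) (fun _ => α) (k (Tr.leaf []))
      (fun _ _ _ => force (Nat.mul bit 2) (fun bit' => splitK bit l
        (fun a b => ih bit' a (fun ta => ih bit' b (fun tb => k (Tr.node bit ta tb)))) [] [])) l) n

/-- check `P` on all entries of a list -/
noncomputable def allL (P : ℕ → ℕ → Bool) (l : List (ℕ × ℕ)) : Bool :=
  @List.rec (ℕ × ℕ) (fun _ => Bool) true
    (fun p _ ih => @Bool.rec (fun _ => Bool) false ih (P p.1 p.2)) l

/-- check `P` on all entries of the trie agreeing with `T` -/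
noncomputable def look (T : ℕ) (P : ℕ → ℕ → Bool) (t : Tr) : Bool :=
  @Tr.rec (fun _ => Bool) (allL P)
    (fun bit _ _ iha ihb => @Nat.rec (fun _ => Bool) iha (fun _ _ => ihb) (Nat.land T bit))
    (fun l => @Nat.rec (fun _ => Bool) (allL P l) (fun _ _ => false) T) t

def tabA : ℕ :=
  105333988604812925032000437402089789502913897011060673417482199836885891575578079749084552727396709528047607467082630803133449984513235938969688365653920495607000684772444275850436692033997471719105811402138614854527107855158024858469782157041163856927665922504854047802217623388445152796925871188534367898179349398225630783706284075994206155614439902311590141764233625671401756877312626930929780187368785665592188552201237248506789258585904387030851244534695145893074830385169578125948273917116430724442647429624018463199707272246209983119377894334888274578841201361340425468834372527143442849163193665650969279217940576479696834589724380098863425326785580169916618569131754195582160246117964018314731733748106666081850847733177158403844696384961346703797243602014872695928856533114284548897141124008069038080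
def tabB : ℕ :=
  125178650073281114331673136850201370963980006148959590917886302376787797632485927426222515580770803832960633018582861463272802807753647427784670125974896345347083073321631618555374132625040340694813979769421340707604016201787351231202742541904993870627790091405582163255617814466768268754839717118379917887112281847037017768804153482013710648431967921894854465613886006332623055202446484607228942026218413871457622427509420844001408158892347438720827776747826419027931462762718145690035938104400772154484505181490076607475539939431739445624116512899407709033987666933999255045926224034501903126141749455457412073868817124958635215427847664261922951251636454333619421381023499817642629724144976573175381361396017426782452603769484461715178654911621696377933224658049910803402449972277450325136151705197960232960
def tabC : ℕ :=
  64339673393098917271696492643150137771842439976161484288394704438196415730814181224994905248239943246693032502330417470051976386530792380650502452680389668054589392072359781092780473886672327698471348462062940641758138686096079430495841526648940128234242102702647850268600501735532654625471604887618815645628754575302021084818086857532973797299848062799751739448055131258245651124572772632708115594710423907633698992635386491523899519276490569736149160786974300347698035702599094006454617188428814355530856770785953153191671096749325909378285724261634901324664121162544853497703425927457817733012176320196931819131233408733762158727931620477042511484029971334584455254826084200213274445285950512496212648559939737504734098409665057349284010946406221692181163310283747454819268156409145376088608845333025259520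

/-- table lookup of 21-bit entries -/
def tabL (t c : ℕ) : ℕ := Nat.land (Nat.shiftRight t (Nat.mul 21 c)) 2097151

/-- packed values of a row from its transform -/
def vals (x : ℕ) : ℕ :=
  Nat.xor (tabL tabA (Nat.land x 127)) (Nat.xor (tabL tabB (Nat.land (Nat.shiftRight x 7) 127))
    (tabL tabC (Nat.land (Nat.shiftRight x 14) 127)))

/-- number of nonzero octal digits (at most 7 digits) -/
def wtV (V : ℕ) : ℕ :=
  Nat.land (Nat.shiftRight (Nat.mul (Nat.land (Nat.lor (Nat.lor V (Nat.shiftRight V 1))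
    (Nat.shiftRight V 2)) 299593) 299593) 18) 7

noncomputable def wt21 (x : ℕ) : ℕ := force (vals x) wtV

/-- xor of the three parts of all lanes -/
def fold3 (y : ℕ) : ℕ := Nat.xor (Nat.xor y (Nat.shiftRight y 21)) (Nat.shiftRight y 42)

def bigTab : List ℕ := 
  [1174271571355076135892453925390142487609869255052411853427418824952798431638778625749386714328365713827299329,
    880704028476506504194839042135817607602960231763164709360177212691338833633347188615811190264912941129138178,
    1761407357032781077825862209185418934999541709493108010992637266750190744879557133860582568936656483083354116,
    9394172570840609087139631403121139900878954040419294827419350599622387453110229005995093714626925710618394632,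
    7045632227812052033558712337086540860823681854105317674881417701530710669066777508926489522119303529033105424,
    14091258856262248622606897673483351479996333675944864087941098134001525959036457070884660551493251864666832928,
    75153380566724872697117051224969119207031632323354358619354804796979099624881832047960749717015405684947157056,
    56365057822496416268469698696692326886589454832842541399051341612245685352534220071411916176954428232264843392,
    112730070850097988980855181387866811839970669407558912703528785072012207672291656567077284411946014917334663424,
    601227044533798981576936409799752953656253058586834868954838438375832796999054656383685997736123245479577256448,
    450920462579971330147757589573538615092715638662740331192410732897965482820273760571295329415635425858118747136,
    901840566800783911846841451102934494719765355260471301628230280576097661378333252536618275295568119338677307392,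
    4809816356270391852615491278398023629250024468694678951638707507006662375992437251069487981888985963836618051584,
    3607363700639770641182060716588308920741725109301922649539285863183723862562190084570362635325083406864949977088,
    7214724534406271294774731608823475957758122842083770413025842244608781291026666020292946202364544954709418459136,
    38478530850163134820923930227184189034000195749557431613109660056053299007939498008555903855111887710692944412672,
    28858909605118165129456485732706471365933800874415381196314286905469790900497520676562901082600667254919599816704,
    57717796275250170358197852870587807662064982736670163304206737956870250328213328162343569618916359637675347673088,
    307828246801305078567391441817473512272001565996459452904877280448426392063515984068447230840895101685543555301376,
    230871276840945321035651885861651770927470406995323049570514295243758327203980165412503208660805338039356798533632,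
    461742370202001362865582822964702461296519861893361306433653903654962002625706625298748556951330877101402781384704]

/-- all words with twelve leading zero bits -/
noncomputable def hiL : List (ℕ × ℕ) :=
  (List.range 512).map (fun h => (lin bigTab (Nat.mul 4096 h), wt21 (Nat.mul 4096 h)))

/-- data of a search instance: row positions, weight bounds (4 means no bound) and masks -/
structure Inst where
  (p0 p1 p2 p3 p4 p5 p6 : ℕ)
  (k0 k1 k2 k3 k4 : ℕ)
  (m0 m1 m2 m3 m4 : ℕ)

noncomputable def finalOK (A acc : ℕ) : Bool :=
  force (fold3 A) (fun F => force (Nat.land (Nat.shiftRight F 63) 2097151) (fun x =>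
    force (Nat.land F 2097151) (fun y =>
    force (Nat.add acc (Nat.add (wt21 x) (wt21 y))) (fun t =>
     @Bool.rec (fun _ => Bool) (Nat.beq t 0) true (Nat.ble 16 t)))))

/-- last level -/
noncomputable def lev4 (m4 : ℕ) (t4 : Tr) (A acc : ℕ) : Bool :=
  force (Nat.land (Nat.shiftRight (fold3 A) 126) 4095) (fun T => look T (fun x w =>
    force (Nat.xor A (Nat.land m4 x)) (fun A' => finalOK A' (Nat.add acc w))) t4)

noncomputable def lev3 (m3 m4 : ℕ) (t3 t4 : Tr) (A acc : ℕ) : Bool :=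
  force (Nat.land (Nat.shiftRight (fold3 A) 189) 511) (fun T => look T (fun x w =>
    force (Nat.xor A (Nat.land m3 x)) (fun A' => lev4 m4 t4 A' (Nat.add acc w))) t3)

noncomputable def lev2 (m2 m3 m4 : ℕ) (t2 t3 t4 : Tr) (A acc : ℕ) : Bool :=
  force (Nat.land (Nat.shiftRight (fold3 A) 252) 63) (fun T => look T (fun x w =>
    force (Nat.xor A (Nat.land m2 x)) (fun A' => lev3 m3 m4 t3 t4 A' (Nat.add acc w))) t2)

noncomputable def lev1 (m1 m2 m3 m4 : ℕ) (t1 t2 t3 t4 : Tr) (A acc : ℕ) : Bool :=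
  force (Nat.land (Nat.shiftRight (fold3 A) 315) 7) (fun T => look T (fun x w =>
    force (Nat.xor A (Nat.land m1 x)) (fun A' => lev2 m2 m3 m4 t2 t3 t4 A' (Nat.add acc w))) t1)

noncomputable def run (l0 : List (ℕ × ℕ)) (t1 t2 t3 t4 : Tr) (I : Inst) : Bool :=
  force I.m0 (fun m0 => force I.m1 (fun m1 => force I.m2 (fun m2 => force I.m3 (fun m3 =>
  force I.m4 (fun m4 => allL (fun x w => force (Nat.land m0 x) (fun A =>
    lev1 m1 m2 m3 m4 t1 t2 t3 t4 A w)) l0)))))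

/-- the trie of all words of kind `kd` (weight at most `kd`), on `n` bits -/
noncomputable def mkT (kd n : ℕ) (k : Tr → Bool) : Bool :=
  @Bool.rec (fun _ => Bool) (forceL (ws [0, 1, 2, 3, 4, 5, 6] kd) (fun l => buildK n 1 l k) [])
    (forceL hiL (fun l => k (Tr.zero l)) []) (Nat.beq kd 4)

/-- normalised first rows -/
noncomputable def nrmL (kd : ℕ) : List (ℕ × ℕ) :=
  match kd with
  | 0 => [(0, 0)]
  | b + 1 => (0, 0) :: (ws (if b = 2 then [1, 2, 3, 4] else [1, 2, 3]) b).map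
      (fun p => (Nat.xor (lin (basisR 0) 1) p.1, Nat.succ p.2))

/-- a batch of instances sharing the same tries -/
noncomputable def batch (k0 k1 k2 k3 k4 s n : ℕ) (Is : List Inst) : Bool :=
  forceL (((nrmL k0).drop s).take n) (fun l0 => mkT k1 3 (fun t1 => mkT k2 6 (fun t2 =>
    mkT k3 9 (fun t3 => mkT k4 12 (fun t4 =>
      @List.rec Inst (fun _ => Bool) true (fun I _ ih => @Bool.rec (fun _ => Bool) false ih
        (run l0 t1 t2 t3 t4 I)) Is))))) []

/-- selection by a number -/
noncomputable def sel {α : Type} (a b c d : α) (k : ℕ) : α :=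
  @Nat.rec (fun _ => α) a (fun k _ => @Nat.rec (fun _ => α) b (fun k _ =>
    @Nat.rec (fun _ => α) c (fun _ _ => d) k) k) k

/-- instances of mixed kinds -/
noncomputable def mixed (Is : List Inst) : Bool :=
  forceL (nrmL 1) (fun l1 => forceL (nrmL 2) (fun l2 => forceL (nrmL 3) (fun l3 =>
  mkT 0 3 (fun a0 => mkT 1 3 (fun a1 => mkT 0 6 (fun b0 => mkT 1 6 (fun b1 => mkT 2 6 (fun b2 =>
  mkT 2 9 (fun c2 => mkT 3 9 (fun c3 => mkT 2 12 (fun d2 => mkT 3 12 (fun d3 => mkT 4 12 (fun d4 =>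
      @List.rec Inst (fun _ => Bool) true (fun I _ ih => @Bool.rec (fun _ => Bool) false ih
        (run (sel (nrmL 0) l1 l2 l3 I.k0) (sel a0 a1 a1 a1 I.k1) (sel b0 b1 b2 b2 I.k2)
          (sel c2 c2 c2 c3 I.k3) (sel d2 d2 d2 (sel d3 d4 d4 d4 (Nat.sub I.k4 3)) I.k4) I)) Is
  ))))))))))) []) []) []

/-! ### The search instances -/

/-- instances of mixed kinds -/
def instA : List Inst := [
  ⟨0, 2, 6, 4, 5, 1, 3, 1, 0, 2, 3, 3,
    2054974759927104074626096332102710246208110431426866051972893948908251412186816891585808729638954524747791879,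
    405273858322617699365676888378316112219908345342512897546670604251725765018104,
    1545991181681086289893935691115783913429182349741554357650295831279173120,
    1340933598257652835968027443059734968536965118555033088,
    75599877754502937251682750673486868480⟩,
  ⟨0, 3, 4, 1, 6, 2, 5, 1, 0, 2, 3, 3,
    979888791951958657213405486446003647988566732849080453340651435447219834455816664869442472183550737983,
    1782407329210720946553689848493209763328608930149521416253195322156251016033279517015379960,
    737186393199106039556921665143573651166401801256047666023261827520,
    1340934237664619157915768487679256025807428780451663360,
    84904474279577825444837752037080793088⟩,
  ⟨0, 1, 2, 4, 6, 3, 5, 1, 0, 2, 3, 3,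
    979888324703012143778710627787018930194086325021959421757150281279748042330720846458920776892087009223,
    1782407329210315675980598676162311350363753142711970545775759957529571739986193243948970040,
    1545991181681437807423500645456656941318378599731038712419362365759061952,
    639406966417174500993704782165162248038157913600,
    84904473724978572232873510386081431552⟩,
  ⟨0, 3, 5, 1, 2, 4, 6, 1, 0, 2, 3, 3,
    979888791951958657213405942377355019183900171478760301345312842715921253132377724830318166610469159367,
    1782407329210720948099681030173944534184429288959349901417501672122304127554741337241452480,
    351517864798993311947815428702258152718509303105562018054144,
    1340934237664924052079603659598485714516756755787280384,
    75599882745860250688861413837403058176⟩,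
  ⟨0, 1, 5, 3, 4, 2, 6, 1, 0, 2, 3, 3,
    979888324703012143884949978217316043274783896673108547717579760389965365549963426476675442771006091719,
    1782407329210720946553689848493209763496226189413171319578653432705274132737909105792876992,
    737186393198938422857139801478716721005994354856116486963735032256,
    639406966333578521571295908513466783288231460352,
    9304636456102645322480066469736218624⟩,
  ⟨0, 4, 6, 1, 5, 2, 3, 1, 0, 2, 3, 3,
    2054975739815428779197845780193618396807354724705757120316331637591662238304957379388554419880681310171136455,
    1782406479293080599536461400619452143869048033970576424813800056143816342345138818643128768,
    1545991181681086288553002732265135606278887628401247143914188029728395200,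
    1340934237664619168238023099733994849881287277209186304,
    10467675458199491479555780733212323840⟩,
  ⟨0, 2, 1, 5, 6, 3, 4, 1, 0, 2, 3, 3,
    2054974759927104076185702107723455542108898320554960944817400830146964138361260500819831933810567741813035000,
    849918045621068799963283215142663013281548216067112810802484817079497353923712512448,
    1545991918867127969626626436240904756582907226042757379174378410895966208,
    639407271299852940505585819735767996105698308096,
    10467675458199491479555780733212323840⟩,
  ⟨0, 3, 6, 2, 5, 1, 4, 1, 0, 2, 3, 3,
    979888791951958657107165832061665535746899528490198574369545024576456487869421104638304832415730995136,
    1782407329210315674434607494481532641471952714365832243956845413282546754622005906333790264,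
    737186041681408857183466396219170341964189445434957682691450634176,
    1340933598257652761531228621681698505266010674140515840,
    84904474279577825444837752037080793088⟩,
  ⟨0, 6, 1, 3, 4, 2, 5, 1, 0, 2, 3, 3,
    2054974759927571323349810656721214529527104073408771003481718616181486616080305474531594464168342786410315719,
    849918045622614791144964345369587229412979242551567066657162901435941998031607401984,
    1545991181681437806082567047199042376316718917460760040006732375486860800,
    1340934237664923986802016427332433802306795243577507840,
    84904474279594485954798122942960005120⟩,
  ⟨0, 1, 4, 2, 3, 5, 6, 1, 0, 2, 3, 3,
    979888324703012143884950332830613488011289824470051626504706640758971553915360666366669364208110665671,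
    1782407329210720946746938838351556818457904391674525660600932098001403272974084699217231808,
    737186041679900306885426536875386882634811659288137099828200206336,
    1340934237664619158933427059930048389952042936972348928,
    74436772755329791734798315175089766400⟩,
  ⟨0, 1, 2, 6, 5, 3, 4, 1, 1, 1, 2, 3,
    979888324703012143778710627787018929445381361475865361760271600551866793867441959906252155821854818808,
    1782407329210315674434607494481532640131019196034050274104727891564288405161002852748856888,
    737186041679900307604759069106044517137295331190543013594559414208,
    1340934237664619093946640133107134558775995148023922176,
    74436768318571467065131299645996396544⟩,
  ⟨0, 4, 1, 2, 5, 3, 6, 1, 0, 2, 3, 3,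
    2054975739815428778975045076522093639559737869483170296185395809925011491984829479694696336221703828160876487,
    1782406479292675325678139612254427298089213618165997704368365126041549746011058060375588920,
    737186393198938422217732530327882705331766209431288760575639453632,
    304967582949354998493503847147718918245888,
    84904474279594485954798122942960005120⟩,
  ⟨0, 3, 5, 4, 6, 1, 2, 1, 0, 2, 3, 3,
    979888791951958657213405942377572424931010423495949836907832315797198276014486433851076349613442331128,
    1782407329210720946746938838351600759364320454971895420726132751059135886730351202487500736,
    1545991918867127969626626516166737437509255041225901203396597616490581504,
    639407271235883847645213844150176714594218442240,
    74436772755329791734798315175089766400⟩,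
  ⟨0, 6, 3, 4, 5, 1, 2, 1, 0, 2, 3, 3,
    2054974759927571323349810656721670459356641673647319702898363774539527406648182418153479151001304145976356920,
    849918045621068799963283215141489696313137971197545216688588638692641495763948372024,
    1545991918867127969794242496616106906570725205483617765115134077779050432,
    1340933598257957654531990267819308255451579023168925696,
    75599846697061380484330682419378913280⟩,
  ⟨0, 3, 1, 4, 5, 2, 6, 1, 0, 2, 3, 3,
    979888791949953449924201631975816891198965506251617223678498322881630233284075847516348302844424388103,
    405272505579596542768952081140809966502084543342915948447631828151246604464128,
    1545991918867127968285692198576590502299199251444407350606721905269374976,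
    1340933598257652760368190174183841114708901289726312448,
    9304632019310470728855034526183976960⟩,
  ⟨0, 1, 3, 2, 6, 4, 5, 1, 0, 2, 3, 3,
    979888324702789342225121158723664458381009876022487892839770921301745217837274712884979058315330616839,
    405274051570778223459784230513660703875598841110983175333680863823240795783672,
    737186041680067924224615366796750439820013102173673696454362004992,
    639406966406852183850805523421768048164825173504,
    74436768318571467065131299645996396544⟩,
  ⟨0, 2, 5, 3, 6, 1, 4, 1, 0, 2, 3, 3,
    2054974759927104076408502917634685342951072255795357054840035913075986634883132791775233947010741582937948216,
    849917640350302459801093969673542210455762058357294629404440122245756091123133026240,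
    1545991918867127968285692917909122807375424198083956001172260179905843136,
    1340934237664924061238815872651026187483657639221558784,
    83741404220057669744499770613055647744⟩,
  ⟨0, 4, 3, 1, 5, 2, 6, 1, 0, 2, 3, 3,
    2054975739815428778975045076521739026262293225125140701580286182335059087980103886724596999254660523061182407,
    1782406479292675325678139612254734875906630226333985949376600035231141593034028337019486264,
    737186393197765105878738484521860836741237157252946776205530755072,
    304903613856425299793163750648602830012416,
    9304632019310470728855034526183976960⟩,
  ⟨0, 1, 6, 2, 5, 3, 4, 1, 0, 2, 3, 3,
    979888324703012143778710273172199649720037870628319206689541541105676252767312305421614902544290283576,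
    1782407329210315675980598676162618928348787809401897381589005125575185680330005687291580408,
    1545991181681437807591117904719654193404505425957624249765751649738719168,
    639406966417174469381652865170798975245980270080,
    74436768318571467065131299645996396544⟩,
  ⟨0, 4, 2, 1, 6, 3, 5, 1, 0, 2, 3, 3,
    2054975739815428779197845780193973010080644005554593324176054574573076545644266482741931805794153942749543999,
    1782406479293080599536461400619803661587181775565822170596601229683192242209152968255344184,
    1545991918867127969794242496616411725134723039168659808371955789320716224,
    304968600643976048189129072110782283771904,
    84904473724978572232873510386081431552⟩,
  ⟨0, 3, 4, 1, 2, 5, 6, 3, 0, 1, 2, 4,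
    979888791951958657213405486446003647988566732849248070040433303195613108275070816992971874010872938439,
    1782407329210720946553689848493209762155292591155513868403813412042856191399570114380529664,
    737186393197765105958664355397263133415272111668385741034081218560,
    1340933598257957654531990267819308255451579023168925696,
    75599846697061380484330682419378913280⟩,
  ⟨0, 1, 6, 3, 2, 4, 5, 3, 0, 1, 2, 4,
    979888324703012143778710273173721483971689430445932252349918952144454148024269667365774236765279518663,
    1782407329210315675787349686304271873533774209459235198321199177530129154235183969053969976,
    1545991918867479487491424150739224715277069867739991433797960969295756800,
    304978050588209767631414637799703700566016,
    74436772755329791734798315175089766400⟩,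
  ⟨0, 2, 1, 5, 3, 4, 6, 3, 0, 1, 2, 4,
    2054974759927104076185702107723455542108898320554960944835733907934518072807175973613076451008848370130190399,
    849918045621068799963283215141489696313137671069806086654108622350844183965698617400,
    1545991918867127969626625876760075998403577965787058922665086748390060480,
    1340933598257652836113412240388130504472534881603948032,
    4991393278981321005179432890368⟩,
  ⟨0, 5, 1, 6, 2, 3, 4, 3, 0, 1, 2, 4,
    2054975739815896024356746296309942224879824321125945134704328894744380915244945487757562611646080513593836024,
    1782406479292675327224130793935865104192732033504635766004932212452244186956742820760908280,
    1545991181681437806082567047199004264673419684571772365095431235577020864,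
    639407271235883847714538486350173772594781388288,
    84904442667540717800844011452781293568⟩,
  ⟨0, 3, 2, 5, 1, 4, 6, 3, 0, 1, 2, 4,
    979888791951958657107166186673392833857585815799340848837852159233174432892159922797577144127411163079,
    1782407329210315674434608231667618259722521610836248482803475057191266939311204130214412224,
    1545991918867479487491424230664790614973176395439299555986151505538580416,
    639407271310320646466607020522393598200997740544,
    75599877754502937251682750673486868480⟩,
  ⟨0, 1, 4, 6, 5, 2, 3, 1, 1, 1, 2, 3,
    979888324703012143884950332830613488011289786022806116921618487878837262453926917670630205872943366207,
    1782407329210720948292930020032643108037558700763268485223394094470885295039968623915692088,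
    1545991181681086288553002732265402386618686469376145955252090685045862848,
    639406966407869873480498136997701561519412350464,
    10467675458199491479555780733212323840⟩,
  ⟨0, 1, 5, 4, 2, 3, 6, 1, 1, 1, 2, 3,
    979888324703012143884949978217340198741959871683987782373755262292090895309166391276082129482717040583,
    1782407329210720948292929282846645367849398882695412341188145797108740621395684576997441472,
    737186393197765105319257350953368043237430499810991294453584527296,
    1340934237664923986947400739371408975921411731975274496,
    74436803812771612946602976964335861760⟩,
  ⟨0, 6, 1, 2, 3, 4, 5, 1, 0, 2, 3, 3,
    2054974759927571323349810656721214527812020739750564977160937501012763946440706222249215700560115742371774407,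
    849918045622614790315630048481040317125725465714941370022389338779311909790982336512,
    1545991181681437807591117904719692370143598770922549255779096040776138752,
    304967582918297556705348592103426009038848,
    84904442667540717800844011452781293568⟩,
  ⟨0, 1, 4, 5, 2, 3, 6, 3, 0, 1, 2, 4,
    979888324703012143884950332829067497578313273314396163809329562633159616615039496572678932837519298503,
    1782407329210720946746938838351600759364320454971590537175391803721017499468274516235157440,
    1545991918867127969626626516167042265523228720667261789365966411493507072,
    304978050619821821366512042293697542389248,
    74436803812771612946602976964335861760⟩,
  ⟨0, 2, 6, 5, 1, 3, 4, 3, 0, 1, 2, 4,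
    2054974759927104074626096332102710246208111168612517768433821143971887718758701974408461287751452790609416184,
    405273858321880513323996820454171422728751986204041434851325537587451413131264,
    1545991918867127968285692837983556834551017441019166715332563407696854528,
    1340933598257957718501083197515926041008393330303958528,
    74436772755329791734798315175089766400⟩,
  ⟨0, 3, 5, 1, 2, 4, 6, 3, 0, 1, 2, 4,
    979888791951958657213405942377355019183900171478760301345312842715921253132377724830318166610469159367,
    1782407329210720948099681030173944534184429288959349901417501672122304127554741337241452480,
    351517864798993311947815428702258152718509303105562018054144,
    1340934237664924052079603659598485714516756755787280384,
    75599882745860250688861413837403058176⟩,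
  ⟨0, 6, 3, 5, 1, 2, 4, 3, 0, 1, 2, 4,
    2054974759927571323349810656721670460902632855328367543865384133553293544091370639107126301027870939250160120,
    849918045622614790407778259751315707699712522297238218973661626532461536338495402432,
    1545991181681086289726318991333577328996213989418315514073310781884861952,
    639406966417319884820454336976392860872153726976,
    4991393278981321005179432890368⟩,
  ⟨0, 1, 2, 3, 5, 4, 6, 1, 1, 1, 2, 3,
    979888324703012143778710627786994773252538266651279572770641296349386970844872159862637940954674200583,
    1782407329210315674241359241808875747351514207538437922337476615110409973242752618270556096,
    1545991181681437807423500645456695128543351499305918317915803389285101568,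
    1340934237664923976334346515125210070574861970164183040,
    84904474279592634795207284244958937088⟩,
  ⟨0, 1, 3, 2, 4, 5, 6, 3, 0, 1, 2, 4,
    979888324702789342225121158723664458381009876022320275501830899232156983646064741093234929700383748103,
    405274051570778223459783057196762228434140608678459158471772031956119096950272,
    737186041679900306885426536864919212722600733222091403550508679168,
    1340934237664619159078811371969023563535134243010904064,
    84904442667540717800844011452781293568⟩,
  ⟨0, 1, 3, 2, 5, 4, 6, 1, 1, 1, 2, 3,
    979888324702789342225121158723664458381009876022487892121687230876496712107466928442667806348388827143,
    405274051570778223459784230513580777742789884859578736009360596441396886633984,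
    737186041681408857902799195147444070292749461362621310815040204800,
    1340933598257957719809581936843651781756218732716486656,
    84904474279592634795207284244958937088⟩,
  ⟨0, 2, 3, 4, 6, 1, 5, 2, 0, 2, 2, 3,
    2054974759927104076185702107723100928835609039706163189400075651720455851973034971153476381541799114085204423,
    849918045622614790407777908233618526675005979901794848409737384435562569837928772032,
    737186041681408857822873057584002839822807914342644836170118991808,
    1340933598257652760513570049430608638101580557179940864,
    10467670466825253081911318596344901632⟩,
  ⟨0, 6, 5, 2, 3, 1, 4, 1, 0, 2, 3, 3,
    2054974759927571323572611466632849604082663757251234651846525980113032290310769064801255425353327578813009464,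
    849917640350302459708945714464895605063924861470302562964891722057730185235657424832,
    1545991918867479486150491271814409098630386467414710579003461943947136512,
    1340934237664923986802016427332433802306795243577507840,
    84904474279594485954798122942960005120⟩,
  ⟨0, 1, 2, 4, 6, 3, 5, 2, 0, 2, 2, 3,
    979888324703012143778710627787018930194086325021959421757150281279748042330720846458920776892087009223,
    1782407329210315675980598676162311350363753142711970545775759957529571739986193243948970040,
    1545991181681437807423500645456656941318378599731038712419362365759061952,
    639406966417174500993704782165162248038157913600,
    84904473724978572232873510386081431552⟩,
  ⟨0, 4, 6, 3, 1, 2, 5, 3, 0, 1, 2, 4,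
    2054975739815428779197845780193618398353345169201114799101178303284690326672304925560754252795534796893487103,
    1782406479293080597990470218938717373201795823009064154527266579447922510338896050662703096,
    1545991181681437806250184306462306409778511759442667806448442407317901248,
    1340934237664923986947400739371408975921411731975274496,
    74436803812771612946602976964335861760⟩,
  ⟨0, 1, 3, 4, 5, 2, 6, 2, 0, 2, 2, 3,
    979888324702789342225121158723664459129714098085939460287482400393716715692450231845164175519853084167,
    405274051571515409545402502033935304969170784246494604554895887077447026311168,
    351517864799073238123416058295672788300086547795704847527936,
    1340933598257652760368190174183841114708901289726312448,
    9304632019310470728855034526183976960⟩,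
  ⟨0, 4, 6, 1, 2, 3, 5, 3, 0, 1, 2, 4,
    2054975739815428779197845780193618396807354724705757120169666474543332344432725290148658046178932788507701759,
    1782406479293080599536461400619452145063316380511527191426695610613382160954055422360948728,
    1545991181681086288553002732265135615728898959691866847607825459115426240,
    639406966408015293772011340175849851440303697920,
    4991393278981321005179432890368⟩,
  ⟨0, 1, 6, 2, 3, 4, 5, 3, 0, 1, 2, 4,
    979888324703012143778710273172199649720037870627143270770141230708866041938712983157328890170911260615,
    1782407329210315675980598676162618929836385930052414374596930066126836978083437693779050552,
    1545991181681437807591117345238901721263181217452670892743468329419927552,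
    304967582918297556705348592103426009038848,
    84904442667540717800844011452781293568⟩,
  ⟨0, 2, 5, 6, 1, 3, 4, 2, 0, 2, 2, 3,
    2054974759927104076408502917634685344327971377647276730950816728589243262720437556908056585550131982667353656,
    849917640350302460446132107661152159925290649523558433934288642701892280737874571712,
    737186393198938422217732835211578830591143269935584311079109656512,
    639407271235883847645213844150176714594218442240,
    74436772755329791734798315175089766400⟩,
  ⟨0, 1, 5, 3, 6, 2, 4, 1, 1, 1, 3, 3,
    979888324703012143884949978217316043274783896674449480755107166872847387264621403761818570542020820984,
    1782407329210720946553689848493209762155292591155208901093495768942759157593124095372591096,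
    737186393199106038917514736922928719042781643930069212134012587968,
    639407271310320646466607020522393598200997740544,
    75599877754502937251682750673486868480⟩,
  ⟨0, 1, 2, 3, 4, 5, 6, 2, 1, 1, 2, 3,
    979888324703012143778710627786994773252538266651279572770641300507378260219961231669289441447865741319,
    1782407329210315674241359241808875746010580529355219207754112812354214951957052906964549568,
    1545991181681437807591117904719692370143598770922549255779096040776138752,
    304967582918297556705348592103426009038848,
    84904442667540717800844011452781293568⟩,
  ⟨0, 2, 5, 3, 1, 4, 6, 2, 1, 1, 2, 3,
    2054974759927104076408502917634685342951072255795357054690751651674028807899663171096942657348292586491579967,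
    849917640350302459801093969674883143344677303005482184545251638398638975651181494264,
    1545991918867127968285692917909427700539742640681233405489733576104346048,
    639406966332415416086869043724856118264200986112,
    75599877754502937251682750673486868480⟩,
  ⟨0, 3, 5, 6, 2, 1, 4, 2, 1, 1, 2, 3,
    979888791951958657213405942377572424182305855408606039868850228897362058995895065060497826365573398976,
    1782407329210720946746938838351556819819789447988450281695443546362843860253549470198824952,
    737186041681408857822873324440814786310994602680382245343028281344,
    1340934237664619167220368894965312823719985035383435264,
    10467674903600502713052938452846215168⟩,
  ⟨0, 1, 2, 5, 3, 4, 6, 2, 0, 2, 2, 3,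
    979888324703012143778710627787018930194086286573367739895796698930503197140971937405196934989337296903,
    1782407329210315675980599413348353031584041608858144853382871714656259361457539649634562496,
    737186393197765105878738179703442232023803658705283381404973133824,
    1340933598257652836113412240388130504472534881603948032,
    4991393278981321005179432890368⟩,
  ⟨0, 3, 4, 6, 2, 1, 5, 2, 1, 1, 2, 3,
    979888791951958657213405486444675061068105288809467183406544060310735859247154007286067354572349738559,
    1782407329210720946746938838351205302122607713940109503336740945470757882442358408657764856,
    1545991918867127969794243215948982076722079723343044687830973273220579264,
    1340933598257652761531224184906448874124390817639202304,
    1163110545144785969928728196510117888⟩,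
  ⟨0, 1, 2, 4, 3, 5, 6, 3, 0, 1, 2, 4,
    979888324703012143778710627787018930194086325021956802098067368725894612664990324644794334983814905351,
    1782407329210315675980598676162311350342801764581264583764116190783677638194819220473937856,
    1545991181681437807591117904719692369998214458883574082196004734737583616,
    304978050588209767631414637799703700566016,
    74436772755329791734798315175089766400⟩,
  ⟨0, 2, 4, 5, 1, 3, 6, 3, 0, 1, 2, 4,
    2054974759927104076408502917635039957794509567724385163335939989512623411958767370428491388668070962887888895,
    849917640348756468619413190964482792698217781161958451720216773576450465957394219064,
    1545991181681086288553002732265440434292861229852385254888836900814032832,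
    1340934237664924061238815872651026187483657639221558784,
    83741404220057669744499770613055647744⟩,
  ⟨0, 1, 3, 6, 2, 4, 5, 2, 0, 2, 2, 3,
    979888324702789342225121158725210450299876614024319723762839332526973975596382662477912920807966539271,
    405272505580333728415175913051852836046592533518442317480290508214282711994360,
    1545991181681086288385385393076229470933389958797816424238575603981479936,
    1340933598257957718501083197515926041008393330303958528,
    74436772755329791734798315175089766400⟩,
  ⟨0, 3, 4, 6, 5, 1, 2, 2, 0, 2, 2, 3,
    979888791951958657213405486444675061068105288807958633189679219051372464615141706491375867228424761400,
    1782407329210720946746938838351205302122607713939809439421248540214804928689836765355442112,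
    1545991918867127969626625876760114044732913402888649241849827985960235456,
    639407271299707560699629844488382833219440967680,
    75599846697061380484330682419378913280⟩,
  ⟨0, 1, 5, 6, 2, 3, 4, 2, 1, 1, 2, 3,
    979888324703012143884949978217340199467627343016732451318934341154430415764972954841640200213725184504,
    1782407329210720948292929282846601426796317577672717623294759390822725599753360110713274872,
    1545991918867479487491424230665057395312939265605558901929387690507366848,
    639407271235883847714538486350173772594781388288,
    84904442667540717800844011452781293568⟩,
  ⟨0, 1, 6, 4, 2, 3, 5, 2, 1, 1, 2, 3,
    979888324703012143778710273173745640913237488817953033737046407870052081447052291234702445726644040135,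
    1782407329210315674434608231667618259743473708299753467643204441745386554885393832397238328,
    1545991918867479486150491191888233414095871490678402369182428511145525248,
    1340933598257652836113412240388130504472534881603948032,
    4991393278981321005179432890368⟩,
  ⟨0, 2, 3, 5, 4, 1, 6, 2, 1, 1, 2, 3,
    2054974759927104076185702107723100927289617858025389970311378578926597558526844055829915759995955090470764543,
    849918045622614791144964301429875080986881020456307601432248103187977004317885366264,
    737186393198938422857139763433386840529956971237489283935934320576,
    1340933598257957653368911404053197100035989712127623168,
    75599842814866607952158311720711061504⟩,
  ⟨0, 1, 4, 2, 6, 3, 5, 1, 1, 1, 3, 3,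
    979888324703012143884950332830613488011289824470221862783645965338424364746803130897419461875034488775,
    1782407329210720946746938838351556818478855849731102414182675282021051325262286672877580792,
    737186041680067924224615366796750471432065019168036969246539648512,
    1340933598257957644209704182376680074215810067230129664,
    84904473724978572232873510386081431552⟩,
  ⟨0, 2, 4, 3, 1, 5, 6, 3, 0, 1, 2, 4,
    2054974759927104076408502917635039956224362273829883419391714684967679808430736143889553788282591064220758527,
    849917640348756469356598925065057132038028589350923084600118126550252896477301706296,
    1545991181681437807591117984645563170854736868290822320930469339164045760,
    1340934237664619157915737430237434814018529597417553920,
    10467675458199491479555780733212323840⟩,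
  ⟨0, 1, 5, 6, 4, 2, 3, 2, 0, 2, 2, 3,
    979888324703012143884949978217340199467627343015391517721925568244946882230860027315429289793681330175,
    1782407329210720948292929282846601426963934836935757750816005010954634457827806930788417528,
    1545991918867479487323808170289550288373435936500645041706347998123687872,
    1340934237664924051934188290117953773581597203156959232,
    74436768318571467065131299645996396544⟩,
  ⟨0, 2, 4, 5, 3, 1, 6, 2, 0, 2, 2, 3,
    2054974759927104076408502917635039957794509567724385163335939989512924136500498255593283048780491954759434239,
    849917640348756468619413190964315175359028303343985935631767996880184865344844755000,
    1545991181681086289893935611189951233538657341586899601412282808310927296,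
    639406966341720007620584502867709771711283957248,
    75599846697046571151110853263200583680⟩,
  ⟨0, 3, 4, 5, 1, 2, 6, 1, 0, 2, 2, 4,
    979888791951958657213405486444675061816809554812607327622465755033893173052238145119526981423551250375,
    1782407329210720948292929282846645366487513826381563935238675854789418457099331327978896896,
    737186393198938422217732530253445937498486546941358433556424822272,
    304902450777492212742142683289981448089600,
    10467710952397521749922393147565899776⟩,
  ⟨0, 6, 2, 3, 1, 4, 5, 1, 0, 2, 2, 4,
    2054974759927571321790204031183183499689129593917707762571194466465400595064438517594374202041211693293137927,
    405272312331436018323329388456968795730854560777301372032730738915588639555072,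
    351517697182373455916895467186715883612681158939829090615296,
    639407271310320614854555070471480707919999397888,
    75599846697061380484330682419378913280⟩,
  ⟨0, 2, 4, 1, 6, 3, 5, 1, 1, 1, 3, 3,
    2054974759927104076408502917635039956224362273829921868130061148639697666902583782064340156359270799987965447,
    849917640350302460538280011354783450220113029648136491213756396799239210011639709632,
    1545991918867479486150491271814104205484240994527281572125881390289653248,
    304968600643976048189129072110782283771904,
    84904473724978572232873510386081431552⟩,
  ⟨0, 6, 2, 4, 1, 3, 5, 3, 0, 1, 2, 4,
    2054974759927571321790204031183183498167293787264692792774687743591195542563399565291498244997665281261432839,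
    405273858321880513323996820454091496896071932192601343200335695289212634890240,
    1545991918867127969626625876760075922640147851633557714061510857046392320,
    639406966417319885375068399538742397322210836480,
    75599882745860250688861413837403058176⟩,
  ⟨0, 3, 4, 5, 1, 2, 6, 2, 1, 1, 2, 3,
    979888791951958657213405486444675061816809554812607327622465755033893173052238145119526981423551250375,
    1782407329210720948292929282846645366487513826381563935238675854789418457099331327978896896,
    737186393198938422217732530253445937498486546941358433556424822272,
    304902450777492212742142683289981448089600,
    10467710952397521749922393147565899776⟩,
  ⟨0, 1, 3, 6, 4, 2, 5, 1, 1, 1, 2, 3,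
    979888324702789342225121158725210450299876614025660656802864388536921458970588814644209224683389484551,
    405272505580333728415174572117695097607956669930961122847389313054758685347832,
    1545991181681086289726319550815015799776159990872088563618865277818601472,
    639407271310320646466592211172039828591815396864,
    84904474279594485954798122942960005120⟩,
  ⟨0, 2, 4, 6, 3, 1, 5, 2, 1, 1, 2, 3,
    2054974759927104076408502917635039957601260658496112934789587489430157477436285880295062177670385545450061831,
    849917640350302459708945714463387055405291968375211355430959071864225682842718568384,
    1545991918867479487491424790146190982414960282591076354330136853921132544,
    639407271235738458341800663635514541246345146368,
    9304636456102645322480066469736218624⟩,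
  ⟨0, 1, 5, 6, 2, 3, 4, 1, 0, 2, 2, 4,
    979888324703012143884949978217340199467627343016732451318934341154430415764972954841640200213725184504,
    1782407329210720948292929282846601426796317577672717623294759390822725599753360110713274872,
    1545991918867479487491424230665057395312939265605558901929387690507366848,
    639407271235883847714538486350173772594781388288,
    84904442667540717800844011452781293568⟩,
  ⟨0, 1, 2, 3, 4, 5, 6, 1, 0, 1, 3, 4,
    979888324703012143778710627786994773252538266651279572770641300507378260219961231669289441447865741319,
    1782407329210315674241359241808875746010580529355219207754112812354214951957052906964549568,
    1545991181681437807591117904719692370143598770922549255779096040776138752,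
    304967582918297556705348592103426009038848,
    84904442667540717800844011452781293568⟩,
  ⟨0, 1, 2, 3, 4, 5, 6, 2, 0, 2, 2, 3,
    979888324703012143778710627786994773252538266651279572770641300507378260219961231669289441447865741319,
    1782407329210315674241359241808875746010580529355219207754112812354214951957052906964549568,
    1545991181681437807591117904719692370143598770922549255779096040776138752,
    304967582918297556705348592103426009038848,
    84904442667540717800844011452781293568⟩,
  ⟨0, 1, 2, 6, 3, 4, 5, 2, 0, 2, 2, 3,
    979888324703012143778710627787018929445381361474521809061163250881264980638591966183794118903369334727,
    1782407329210315674434607494481532641283383997045986759291768674761499203617920582309118008,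
    737186041680067923585208743458802156920029722146120743404745753024,
    1340933598257957718646467440230259014625951833171161088,
    84904442667540717800844011452781293568⟩,
  ⟨0, 1, 3, 5, 2, 4, 6, 2, 0, 2, 2, 3,
    979888324702789342225121158725210449574209104245667858533090956761203790208948812256411693808898506759,
    405272505579596542768953422074328298279354720330892704464259622150556463919104,
    1545991918867127969626625876760075922640147851633557714061510857046392320,
    639406966417319885375068399538742397322210836480,
    75599882745860250688861413837403058176⟩,
  ⟨0, 1, 4, 5, 2, 3, 6, 2, 0, 2, 2, 3,
    979888324703012143884950332829067497578313273314396163809329562633159616615039496572678932837519298503,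
    1782407329210720946746938838351600759364320454971590537175391803721017499468274516235157440,
    1545991918867127969626626516167042265523228720667261789365966411493507072,
    304978050619821821366512042293697542389248,
    74436803812771612946602976964335861760⟩,
  ⟨0, 1, 4, 6, 2, 3, 5, 2, 0, 2, 2, 3,
    979888324703012143884950332830613488011289786022973732900819324680403115736555004526889162378043453895,
    1782407329210720948292930020032643106696625102505610961063429281655803893438133165539717624,
    1545991181681086289726318991333577328996213989418315514073310781884861952,
    639406966417319884820454336976392860872153726976,
    4991393278981321005179432890368⟩,
  ⟨0, 2, 3, 5, 1, 4, 6, 2, 0, 2, 2, 3,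
    2054974759927104076185702107723100927289617858025389971649692526843225110770979782985124599383548798198321151,
    849918045622614791144964301431216014665064281981337031025744263201546954066264063992,
    737186393197765105878738179627824181308322066500518751228969910208,
    639407271310320646466607020522393598200997740544,
    75599877754502937251682750673486868480⟩,
  ⟨0, 2, 3, 6, 1, 4, 5, 2, 0, 2, 2, 3,
    2054974759927104076185702107723100927096368948796766224065224774380335789290820475309688719806910519966462407,
    849918045622614790315630048479699384166874779296002463273123339846000456742958236096,
    1545991181681437806250184306462344521385402253508592031653997206825071040,
    1340933598257652825645706348691638030958988355688463872,
    75599846697061380484330682419378913280⟩,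
  ⟨0, 2, 4, 6, 1, 3, 5, 2, 0, 2, 2, 3,
    2054974759927104076408502917635039957601260658496112934789587489430161711027447463896654653824454304647606279,
    849917640350302459708945714464895605063925166279561924897090561421634298586351828928,
    1545991918867479486150491271814104205629625375890898945706030674342576128,
    304977905234955166510673084207330962145280,
    75599882745860250688861413837403058176⟩,
  ⟨0, 3, 4, 5, 1, 2, 6, 2, 0, 2, 2, 3,
    979888791951958657213405486444675061816809554812607327622465755033893173052238145119526981423551250375,
    1782407329210720948292929282846645366487513826381563935238675854789418457099331327978896896,
    737186393198938422217732530253445937498486546941358433556424822272,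
    304902450777492212742142683289981448089600,
    10467710952397521749922393147565899776⟩,
  ⟨0, 3, 5, 6, 1, 2, 4, 2, 0, 2, 2, 3,
    979888791951958657213405942377572424182305855407241535732915602505573628211765904203425696799204307392,
    1782407329210720946746938838351556819798837350524907260848669732180561007458957335050588152,
    737186041679900307524833198314656179236832784574894499073299021824,
    1340933598257957719809576945486338344593318167496093696,
    4991393278981321005179432890368⟩,
  ⟨0, 4, 5, 6, 1, 2, 3, 2, 0, 2, 2, 3,
    2054975739815428777415438557223413038497041493370219145234728007861484521725345727071674459222330587446476807,
    405272505579504394513743266918698365969146784656350315698710947436037480378368,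
    1545991181681086288553002732265402322649593669663236426730877761714159104,
    1340934237664619159078811371969023563535134243010904064,
    84904442667540717800844011452781293568⟩,
  ⟨0, 3, 2, 5, 1, 4, 6, 0, 0, 2, 2, 4,
    979888791951958657107166186673392833857585815799340848837852159233174432892159922797577144127411163079,
    1782407329210315674434608231667618259722521610836248482803475057191266939311204130214412224,
    1545991918867479487491424230664790614973176395439299555986151505538580416,
    639407271310320646466607020522393598200997740544,
    75599877754502937251682750673486868480⟩,
  ⟨0, 1, 2, 4, 3, 5, 6, 0, 0, 0, 3, 4,
    979888324703012143778710627787018930194086325021956802098067368725894612664990324644794334983814905351,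
    1782407329210315675980598676162311350342801764581264583764116190783677638194819220473937856,
    1545991181681437807591117904719692369998214458883574082196004734737583616,
    304978050588209767631414637799703700566016,
    74436772755329791734798315175089766400⟩,
  ⟨0, 1, 4, 5, 2, 3, 6, 0, 0, 0, 3, 4,
    979888324703012143884950332829067497578313273314396163809329562633159616615039496572678932837519298503,
    1782407329210720946746938838351600759364320454971590537175391803721017499468274516235157440,
    1545991918867127969626626516167042265523228720667261789365966411493507072,
    304978050619821821366512042293697542389248,
    74436803812771612946602976964335861760⟩,
  ⟨0, 1, 2, 3, 4, 5, 6, 1, 1, 1, 3, 3,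
    979888324703012143778710627786994773252538266651279572770641300507378260219961231669289441447865741319,
    1782407329210315674241359241808875746010580529355219207754112812354214951957052906964549568,
    1545991181681437807591117904719692370143598770922549255779096040776138752,
    304967582918297556705348592103426009038848,
    84904442667540717800844011452781293568⟩,
  ⟨0, 1, 3, 2, 4, 5, 6, 1, 1, 1, 3, 3,
    979888324702789342225121158723664458381009876022320275501830899232156983646064741093234929700383748103,
    405274051570778223459783057196762228434140608678459158471772031956119096950272,
    737186041679900306885426536864919212722600733222091403550508679168,
    1340934237664619159078811371969023563535134243010904064,
    84904442667540717800844011452781293568⟩,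
  ⟨0, 1, 2, 4, 3, 5, 6, 2, 1, 1, 2, 3,
    979888324703012143778710627787018930194086325021956802098067368725894612664990324644794334983814905351,
    1782407329210315675980598676162311350342801764581264583764116190783677638194819220473937856,
    1545991181681437807591117904719692369998214458883574082196004734737583616,
    304978050588209767631414637799703700566016,
    74436772755329791734798315175089766400⟩,
  ⟨0, 1, 2, 5, 3, 4, 6, 2, 1, 1, 2, 3,
    979888324703012143778710627787018930194086286573367739895796698930503197140971937405196934989337296903,
    1782407329210315675980599413348353031584041608858144853382871714656259361457539649634562496,
    737186393197765105878738179703442232023803658705283381404973133824,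
    1340933598257652836113412240388130504472534881603948032,
    4991393278981321005179432890368⟩,
  ⟨0, 1, 2, 6, 3, 4, 5, 2, 1, 1, 2, 3,
    979888324703012143778710627787018929445381361474521809061163250881264980638591966183794118903369334727,
    1782407329210315674434607494481532641283383997045986759291768674761499203617920582309118008,
    737186041680067923585208743458802156920029722146120743404745753024,
    1340933598257957718646467440230259014625951833171161088,
    84904442667540717800844011452781293568⟩,
  ⟨0, 1, 3, 2, 4, 5, 6, 2, 1, 1, 2, 3,
    979888324702789342225121158723664458381009876022320275501830899232156983646064741093234929700383748103,
    405274051570778223459783057196762228434140608678459158471772031956119096950272,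
    737186041679900306885426536864919212722600733222091403550508679168,
    1340934237664619159078811371969023563535134243010904064,
    84904442667540717800844011452781293568⟩,
  ⟨0, 1, 3, 4, 2, 5, 6, 2, 1, 1, 2, 3,
    979888324702789342225121158723664459129714098085771842947044123187516629602269530626457910536856403463,
    405274051571515409545404010584233344785639988919465967371421225420893714149376,
    351517697182373455916895467186715883612681158939829090615296,
    639407271310320614854555070471480707919999397888,
    75599846697061380484330682419378913280⟩,
  ⟨0, 1, 3, 5, 2, 4, 6, 2, 1, 1, 2, 3,
    979888324702789342225121158725210449574209104245667858533090956761203790208948812256411693808898506759,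
    405272505579596542768953422074328298279354720330892704464259622150556463919104,
    1545991918867127969626625876760075922640147851633557714061510857046392320,
    639406966417319885375068399538742397322210836480,
    75599882745860250688861413837403058176⟩,
  ⟨0, 1, 3, 6, 2, 4, 5, 2, 1, 1, 2, 3,
    979888324702789342225121158725210450299876614024319723762839332526973975596382662477912920807966539271,
    405272505580333728415175913051852836046592533518442317480290508214282711994360,
    1545991181681086288385385393076229470933389958797816424238575603981479936,
    1340933598257957718501083197515926041008393330303958528,
    74436772755329791734798315175089766400⟩,
  ⟨0, 1, 4, 2, 3, 5, 6, 2, 1, 1, 2, 3,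
    979888324703012143884950332830613488011289824470051626504706640758971553915360666366669364208110665671,
    1782407329210720946746938838351556818457904391674525660600932098001403272974084699217231808,
    737186041679900306885426536875386882634811659288137099828200206336,
    1340934237664619158933427059930048389952042936972348928,
    74436772755329791734798315175089766400⟩,
  ⟨0, 1, 4, 3, 2, 5, 6, 2, 1, 1, 2, 3,
    979888324703012143884950332829043341373950943554508502814626272382508016115866414917661396816734977991,
    1782407329210720948099681030173944534016812589177143318002227863509342415433034916230361536,
    351517697182373455916906080240870808838664256814529649045504,
    639407271299707560699629844488382833219440967680,
    75599846697061380484330682419378913280⟩,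
  ⟨0, 1, 4, 5, 2, 3, 6, 2, 1, 1, 2, 3,
    979888324703012143884950332829067497578313273314396163809329562633159616615039496572678932837519298503,
    1782407329210720946746938838351600759364320454971590537175391803721017499468274516235157440,
    1545991918867127969626626516167042265523228720667261789365966411493507072,
    304978050619821821366512042293697542389248,
    74436803812771612946602976964335861760⟩,
  ⟨0, 1, 4, 6, 2, 3, 5, 2, 1, 1, 2, 3,
    979888324703012143884950332830613488011289786022973732900819324680403115736555004526889162378043453895,
    1782407329210720948292930020032643106696625102505610961063429281655803893438133165539717624,
    1545991181681086289726318991333577328996213989418315514073310781884861952,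
    639406966417319884820454336976392860872153726976,
    4991393278981321005179432890368⟩,
  ⟨0, 1, 5, 2, 3, 4, 6, 2, 1, 1, 2, 3,
    979888324703012143884949978217340198730440988265039539484797318719780829766294169769859674099278643655,
    1782407329210720946746938838351205301934038996620268858079285738307230188185725865031889344,
    1545991918867127969626625876759809226314335375457471490870783844395257792,
    639406966408015293772011340175849851440303697920,
    4991393278981321005179432890368⟩,
  ⟨0, 1, 5, 3, 2, 4, 6, 2, 1, 1, 2, 3,
    979888324703012143884949978217316043274783896673108547076923914289389332122430769216888279231755157959,
    1782407329210720946553689848493209763328609569556792706801570360073038741792859662529589696,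
    737186393197765105958664012392637308790677532837691398078252974528,
    1340933598257957644064319870337704900616956177528159744,
    75599882745860250688861413837403058176⟩,
  ⟨0, 1, 6, 2, 3, 4, 5, 2, 1, 1, 2, 3,
    979888324703012143778710273172199649720037870627143270770141230708866041938712983157328890170911260615,
    1782407329210315675980598676162618929836385930052414374596930066126836978083437693779050552,
    1545991181681437807591117345238901721263181217452670892743468329419927552,
    304967582918297556705348592103426009038848,
    84904442667540717800844011452781293568⟩,
  ⟨0, 1, 6, 3, 2, 4, 5, 2, 1, 1, 2, 3,
    979888324703012143778710273173721483971689430445932252349918952144454148024269667365774236765279518663,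
    1782407329210315675787349686304271873533774209459235198321199177530129154235183969053969976,
    1545991918867479487491424150739224715277069867739991433797960969295756800,
    304978050588209767631414637799703700566016,
    74436772755329791734798315175089766400⟩,
  ⟨0, 2, 3, 4, 1, 5, 6, 2, 1, 1, 2, 3,
    2054974759927104076185702107723100928835609039706163188245092470439800965989285733910004633418778535654584831,
    849918045622614790407777908232277593166664626972642742258706210789474990590453878776,
    737186041681408857822873057649116803022371159989846945087193317824,
    1340934237664619168238023099733994849881287277209186304,
    10467675458199491479555780733212323840⟩,
  ⟨0, 2, 3, 6, 1, 4, 5, 2, 1, 1, 2, 3,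
    2054974759927104076185702107723100927096368948796766224065224774380335789290820475309688719806910519966462407,
    849918045622614790315630048479699384166874779296002463273123339846000456742958236096,
    1545991181681437806250184306462344521385402253508592031653997206825071040,
    1340933598257652825645706348691638030958988355688463872,
    75599846697061380484330682419378913280⟩,
  ⟨0, 2, 4, 5, 1, 3, 6, 2, 1, 1, 2, 3,
    2054974759927104076408502917635039957794509567724385163335939989512623411958767370428491388668070962887888895,
    849917640348756468619413190964482792698217781161958451720216773576450465957394219064,
    1545991181681086288553002732265440434292861229852385254888836900814032832,
    1340934237664924061238815872651026187483657639221558784,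
    83741404220057669744499770613055647744⟩,
  ⟨0, 2, 5, 6, 1, 3, 4, 2, 1, 1, 2, 3,
    2054974759927104076408502917634685344327971377647276730950816728589243262720437556908056585550131982667353656,
    849917640350302460446132107661152159925290649523558433934288642701892280737874571712,
    737186393198938422217732835211578830591143269935584311079109656512,
    639407271235883847645213844150176714594218442240,
    74436772755329791734798315175089766400⟩,
  ⟨0, 2, 6, 3, 1, 4, 5, 2, 1, 1, 2, 3,
    2054974759927104074626096332102710247729946238079837083563184172197310326604845616725294924368644385988702215,
    405272312330698832633165844398858567763027045963252185559782437228860896411648,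
    737186041681241240483683884722982000765070085629460626556833758720,
    639407271310320614854555070471480707919999397888,
    75599846697061380484330682419378913280⟩,
  ⟨0, 4, 5, 6, 1, 2, 3, 2, 1, 1, 2, 3,
    2054975739815428777415438557223413038497041493370219145234728007861484521725345727071674459222330587446476807,
    405272505579504394513743266918698365969146784656350315698710947436037480378368,
    1545991181681086288553002732265402322649593669663236426730877761714159104,
    1340934237664619159078811371969023563535134243010904064,
    84904442667540717800844011452781293568⟩,
  ⟨0, 1, 2, 3, 4, 5, 6, 3, 0, 0, 3, 3,
    979888324703012143778710627786994773252538266651279572770641300507378260219961231669289441447865741319,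
    1782407329210315674241359241808875746010580529355219207754112812354214951957052906964549568,
    1545991181681437807591117904719692370143598770922549255779096040776138752,
    304967582918297556705348592103426009038848,
    84904442667540717800844011452781293568⟩,
  ⟨0, 1, 3, 2, 4, 5, 6, 3, 0, 0, 3, 3,
    979888324702789342225121158723664458381009876022320275501830899232156983646064741093234929700383748103,
    405274051570778223459783057196762228434140608678459158471772031956119096950272,
    737186041679900306885426536864919212722600733222091403550508679168,
    1340934237664619159078811371969023563535134243010904064,
    84904442667540717800844011452781293568⟩,
  ⟨0, 1, 4, 2, 3, 5, 6, 3, 0, 0, 3, 3,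
    979888324703012143884950332830613488011289824470051626504706640758971553915360666366669364208110665671,
    1782407329210720946746938838351556818457904391674525660600932098001403272974084699217231808,
    737186041679900306885426536875386882634811659288137099828200206336,
    1340934237664619158933427059930048389952042936972348928,
    74436772755329791734798315175089766400⟩]

/-- instances of kind (2,1,2,2,2) -/
def instB : List Inst := [
  ⟨0, 2, 4, 5, 6, 1, 3, 2, 1, 2, 2, 2,
    2054974759927104076408502917635039957794509567724385164826156570358301250902010577020864576851481243571486663,
    849917640348756468619413190963141859010043218887904507979075542783682248536095457336,
    1545991181681086288553002092858474176314249103069620819296833841278190016,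
    1340934237664924052079603659598485714516756755787280384,
    75599882745860250688861413837403058176⟩,
  ⟨0, 1, 2, 3, 5, 4, 6, 2, 1, 2, 2, 2,
    979888324703012143778710627786994773252538266651279572770641296349386970844872159862637940954674200583,
    1782407329210315674241359241808875747351514207538437922337476615110409973242752618270556096,
    1545991181681437807423500645456695128543351499305918317915803389285101568,
    1340934237664923976334346515125210070574861970164183040,
    84904474279592634795207284244958937088⟩,
  ⟨0, 1, 2, 4, 5, 3, 6, 2, 1, 2, 2, 2,
    979888324703012143778710627787018930194086325020618488240067379172265648587337136526821212361320271367,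
    1782407329210315675980598676162311351872303520677362449724813213009408093043453878360375232,
    1545991181681437806082567047199042376316718917460760040006732375486860800,
    1340934237664923986802016427332433802306795243577507840,
    84904474279594485954798122942960005120⟩,
  ⟨0, 1, 2, 4, 6, 3, 5, 2, 1, 2, 2, 2,
    979888324703012143778710627787018930194086325021959421757150281279748042330720846458920776892087009223,
    1782407329210315675980598676162311350363753142711970545775759957529571739986193243948970040,
    1545991181681437807423500645456656941318378599731038712419362365759061952,
    639406966417174500993704782165162248038157913600,
    84904473724978572232873510386081431552⟩,
  ⟨0, 1, 3, 4, 5, 2, 6, 2, 1, 2, 2, 2,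
    979888324702789342225121158723664459129714098085939460287482400393716715692450231845164175519853084167,
    405274051571515409545402502033935304969170784246494604554895887077447026311168,
    351517864799073238123416058295672788300086547795704847527936,
    1340933598257652760368190174183841114708901289726312448,
    9304632019310470728855034526183976960⟩,
  ⟨0, 1, 3, 4, 6, 2, 5, 2, 1, 2, 2, 2,
    979888324702789342225121158723664459129714098085939459726752463195136461174908548260282225836783599111,
    405274051571515409545403842968252895111341041679858001635661915048858347606008,
    351519205731952162634159621872465761145579128832501632437760,
    1340934237664619168238054711787796060400778854904393728,
    84904474279577825444837752037080793088⟩,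
  ⟨0, 1, 3, 5, 6, 2, 4, 2, 1, 2, 2, 2,
    979888324702789342225121158725210449574209104247176408911056339715294599258352624061529932768261439032,
    405272505579596542768951913524110183985832706952444478890700670414447498264120,
    1545991918867127968453309537765725391245665323399000256549743923088327104,
    1340933598257652835968027443059734968536965118555033088,
    75599877754502937251682750673486868480⟩,
  ⟨0, 2, 3, 4, 5, 1, 6, 2, 1, 2, 2, 2,
    2054974759927104076185702107723100928835609039706163189421027740442068717809708832680850953273756809843995135,
    849918045622614790407777908232277593166664622208689605365569573995479861878230908920,
    737186041681241240563610060408679593643672438263765459105788953024,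
    639406966408015253910342339639128044710446465024,
    9304596525108738124174658626515861504⟩,
  ⟨0, 2, 3, 4, 6, 1, 5, 2, 1, 2, 2, 2,
    2054974759927104076185702107723100928835609039706163189400075651720455851973034971153476381541799114085204423,
    849918045622614790407777908233618526675005979901794848409737384435562569837928772032,
    737186041681408857822873057584002839822807914342644836170118991808,
    1340933598257652760513570049430608638101580557179940864,
    10467670466825253081911318596344901632⟩,
  ⟨0, 2, 3, 5, 6, 1, 4, 2, 1, 2, 2, 2,
    2054974759927104076185702107723100927289617858025389971463743388680769750006734021813581508904236261241487416,
    849918045622614791144964301429875081616297295750081969223735883152386610622875274752,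
    737186393199106039476996137356665754124443344716917187603890994688,
    639406966417174501063014615014774011217114533376,
    83741404220057669744499770613055647744⟩]

/-- instance of kind (2,2,2,2,2) -/
def instC : List Inst := [
  ⟨0, 1, 2, 3, 4, 5, 6, 2, 2, 2, 2, 2,
    979888324703012143778710627786994773252538266651279572770641300507378260219961231669289441447865741319,
    1782407329210315674241359241808875746010580529355219207754112812354214951957052906964549568,
    1545991181681437807591117904719692370143598770922549255779096040776138752,
    304967582918297556705348592103426009038848,
    84904442667540717800844011452781293568⟩]

set_option maxRecDepth 1000000

theorem runA : mixed instA = true := by decide +kernel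

theorem runB : batch 2 1 2 2 2 0 23 instB = true := by decide +kernel

theorem runC0 : batch 2 2 2 2 2 0 6 instC = true := by decide +kernel

theorem runC1 : batch 2 2 2 2 2 6 6 instC = true := by decide +kernel

theorem runC2 : batch 2 2 2 2 2 12 6 instC = true := by decide +kernel

theorem runC3 : batch 2 2 2 2 2 18 6 instC = true := by decide +kernel

/-! ### Soundness of the engine -/

theorem xor_eq (a b : ℕ) : Nat.xor a b = a ^^^ b := rfl
theorem land_eq (a b : ℕ) : Nat.land a b = a &&& b := rfl
theorem lor_eq (a b : ℕ) : Nat.lor a b = a ||| b := rfl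
theorem shr_eq (a b : ℕ) : Nat.shiftRight a b = a >>> b := rfl

theorem force_eq {α : Type} (x : ℕ) (f : ℕ → α) : force x f = f x := by cases x <;> rfl

theorem lin_nil (x : ℕ) : lin [] x = 0 := rfl
theorem lin_cons (c : ℕ) (cs : List ℕ) (x : ℕ) :
    lin (c :: cs) x = (c * (x % 2)) ^^^ lin cs (x / 2) := rfl

theorem lin_zero (cs : List ℕ) : lin cs 0 = 0 := by
  induction cs with
  | nil => rfl
  | cons c cs ih => rw [lin_cons]; simp [ih]

theorem lin_xor (cs : List ℕ) (x y : ℕ) : lin cs (x ^^^ y) = lin cs x ^^^ lin cs y := by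
  induction cs generalizing x y with
  | nil => simp [lin_nil]
  | cons c cs ih =>
    have h1 : (x ^^^ y) / 2 = x / 2 ^^^ y / 2 := by
      simpa [Nat.shiftRight_one] using Nat.shiftRight_xor_distrib (a := x) (b := y) (i := 1)
    have h2 : c * ((x ^^^ y) % 2) = c * (x % 2) ^^^ c * (y % 2) := by
      have := Nat.xor_mod_two_pow (a := x) (b := y) (n := 1)
      simp only [pow_one] at this
      rw [this]
      rcases Nat.mod_two_eq_zero_or_one x with h | h <;>
        rcases Nat.mod_two_eq_zero_or_one y with h' | h' <;> simp [h, h']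
    rw [lin_cons, lin_cons, lin_cons, h1, h2, ih]
    simp only [Nat.xor_assoc, Nat.xor_left_comm]

/-- the word of the entries of `v` at the given positions -/
noncomputable def Xl (v : ℕ → ℕ) : List ℕ → ℕ
  | [] => 0
  | i :: is => lin (basisR i) (v i) ^^^ Xl v is

/-- number of nonzero entries of `v` at the given positions -/
def cnt (v : ℕ → ℕ) : List ℕ → ℕ
  | [] => 0
  | i :: is => (if v i = 0 then 0 else 1) + cnt v is

abbrev seven : List ℕ := [0, 1, 2, 3, 4, 5, 6]

noncomputable def X (v : ℕ → ℕ) : ℕ := Xl v seven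
def wt (v : ℕ → ℕ) : ℕ := cnt v seven

theorem Xl_xor (v w : ℕ → ℕ) (is : List ℕ) :
    Xl (fun i => v i ^^^ w i) is = Xl v is ^^^ Xl w is := by
  induction is with
  | nil => simp [Xl]
  | cons i is ih =>
    simp only [Xl, ih, lin_xor]
    simp only [Nat.xor_assoc, Nat.xor_left_comm]

theorem ws_zero_mem (is : List ℕ) (b : ℕ) : (0, 0) ∈ ws is b := by
  induction is generalizing b with
  | nil => simp [ws]
  | cons i is ih => cases b with
    | zero => simp [ws]
    | succ b => simp only [ws, List.mem_append]; exact Or.inl (ih _)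

theorem cnt_zero {v : ℕ → ℕ} {is : List ℕ} (h : cnt v is = 0) : Xl v is = 0 := by
  induction is with
  | nil => rfl
  | cons i is ih =>
    simp only [cnt, Nat.add_eq_zero_iff] at h
    have : v i = 0 := by by_contra h'; simp [h'] at h
    simp only [Xl, this, lin_zero, ih h.2, Nat.xor_zero]

theorem ws_mem (v : ℕ → ℕ) (hv : ∀ i, v i < 8) (is : List ℕ) (b : ℕ) (h : cnt v is ≤ b) :
    (Xl v is, cnt v is) ∈ ws is b := by
  induction is generalizing b with
  | nil => simp [ws, Xl, cnt]
  | cons i is ih => cases b with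
    | zero =>
      have h0 : cnt v (i :: is) = 0 := Nat.le_zero.mp h
      rw [h0, cnt_zero h0]; simp [ws]
    | succ b =>
      simp only [ws, List.mem_append, List.mem_flatMap, List.mem_map]
      by_cases hi : v i = 0
      · left
        simp only [Xl, cnt, hi, lin_zero, if_true, Nat.zero_xor, zero_add]
        simp only [cnt, hi, if_true, zero_add] at h
        exact ih _ h
      · right
        simp only [cnt, hi, if_false] at h
        refine ⟨v i, ?_, _, ih b (by omega), ?_⟩
        · have := hv i
          interval_cases v i <;> simp_all
        · simp only [Xl, cnt, hi, if_false, xor_eq, Nat.succ_eq_add_one, add_comm 1]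

/-! trie soundness -/

theorem forceL_spec {α : Type} (l : List (ℕ × ℕ)) (k : List (ℕ × ℕ) → α) (acc : List (ℕ × ℕ)) :
    ∃ l', forceL l k acc = k l' ∧ (∀ p ∈ l, p ∈ l') ∧ ∀ p ∈ acc, p ∈ l' := by
  induction l generalizing acc with
  | nil => exact ⟨acc, rfl, by simp, fun p h => h⟩
  | cons p l ih =>
    obtain ⟨l', h1, h2, h3⟩ := ih (p :: acc)
    refine ⟨l', ?_, ?_, fun q hq => h3 q (List.mem_cons_of_mem _ hq)⟩
    · rw [← h1]
      show force p.1 (fun x => force p.2 (fun w => forceL l k ((x, w) :: acc))) = _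
      rw [force_eq, force_eq]
    · intro q hq
      rcases List.mem_cons.mp hq with rfl | hq
      · exact h3 _ List.mem_cons_self
      · exact h2 _ hq

theorem splitK_spec {α : Type} (bit : ℕ) (l : List (ℕ × ℕ))
    (k : List (ℕ × ℕ) → List (ℕ × ℕ) → α) (a b : List (ℕ × ℕ)) :
    ∃ a' b', splitK bit l k a b = k a' b' ∧ (∀ p ∈ l, p.1 &&& bit = 0 → p ∈ a') ∧
      (∀ p ∈ l, p.1 &&& bit ≠ 0 → p ∈ b') ∧ (∀ p ∈ a, p ∈ a') ∧ ∀ p ∈ b, p ∈ b' := by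
  induction l generalizing a b with
  | nil => exact ⟨a, b, rfl, by simp, by simp, fun p h => h, fun p h => h⟩
  | cons p l ih =>
    have key : splitK bit (p :: l) k a b = @Nat.rec (fun _ => α) (splitK bit l k (p :: a) b)
      (fun _ _ => splitK bit l k a (p :: b)) (p.1 &&& bit) := rfl
    rw [key]
    rcases h : p.1 &&& bit with _ | m
    · obtain ⟨a', b', h1, h2, h3, h4, h5⟩ := ih (p :: a) b
      refine ⟨a', b', h1, ?_, ?_, fun q hq => h4 q (List.mem_cons_of_mem _ hq), h5⟩
      · intro q hq hq0
        rcases List.mem_cons.mp hq with rfl | hq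
        · exact h4 _ List.mem_cons_self
        · exact h2 _ hq hq0
      · intro q hq hq0
        rcases List.mem_cons.mp hq with rfl | hq
        · exact absurd h hq0
        · exact h3 _ hq hq0
    · obtain ⟨a', b', h1, h2, h3, h4, h5⟩ := ih a (p :: b)
      refine ⟨a', b', h1, ?_, ?_, h4, fun q hq => h5 q (List.mem_cons_of_mem _ hq)⟩
      · intro q hq hq0
        rcases List.mem_cons.mp hq with rfl | hq
        · rw [h] at hq0; omega
        · exact h2 _ hq hq0
      · intro q hq hq0
        rcases List.mem_cons.mp hq with rfl | hq
        · exact h5 _ List.mem_cons_self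
        · exact h3 _ hq hq0

theorem allL_spec (P : ℕ → ℕ → Bool) (l : List (ℕ × ℕ)) (h : allL P l = true) :
    ∀ p ∈ l, P p.1 p.2 = true := by
  induction l with
  | nil => simp
  | cons p l ih =>
    have key : allL P (p :: l) = @Bool.rec (fun _ => Bool) false (allL P l) (P p.1 p.2) := rfl
    rw [key] at h
    rcases hp : P p.1 p.2 with _ | _
    · rw [hp] at h; exact absurd h (by simp)
    · rw [hp] at h
      intro q hq
      rcases List.mem_cons.mp hq with rfl | hq
      · exact hp
      · exact ih h _ hq

theorem buildK_spec {α : Type} (n : ℕ) : ∀ (bit : ℕ) (l : List (ℕ × ℕ)) (k : Tr → α),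
    ∃ t, buildK n bit l k = k t ∧ ∀ T P, look T P t = true → ∀ p ∈ l,
      (∀ i < n, p.1 &&& (bit * 2 ^ i) = T &&& (bit * 2 ^ i)) → P p.1 p.2 = true := by
  induction n with
  | zero => exact fun bit l k => ⟨Tr.leaf l, rfl, fun T P h p hp _ => allL_spec P l h p hp⟩
  | succ n ih =>
    intro bit l k
    rcases l with _ | ⟨p0, l0⟩
    · exact ⟨Tr.leaf [], rfl, by simp⟩
    · generalize hl : p0 :: l0 = l
      have key : buildK (n + 1) bit l k = force (bit * 2) (fun bit' => splitK bit l
        (fun a b => buildK n bit' a (fun ta => buildK n bit' b (fun tb => k (Tr.node bit ta tb))))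
          [] []) := by subst hl; rfl
      rw [key, force_eq]
      obtain ⟨a, b, h1, h2, h3, -, -⟩ := splitK_spec bit l (fun a b => buildK n (bit * 2) a
        (fun ta => buildK n (bit * 2) b (fun tb => k (Tr.node bit ta tb)))) [] []
      rw [h1]
      obtain ⟨ta, e1, s1⟩ := ih (bit * 2) a (fun ta => buildK n (bit * 2) b
        (fun tb => k (Tr.node bit ta tb)))
      obtain ⟨tb, e2, s2⟩ := ih (bit * 2) b (fun tb => k (Tr.node bit ta tb))
      refine ⟨Tr.node bit ta tb, e1.trans e2, ?_⟩
      intro T P h p hp hag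
      have key2 : look T P (Tr.node bit ta tb) = @Nat.rec (fun _ => Bool) (look T P ta)
        (fun _ _ => look T P tb) (T &&& bit) := rfl
      rw [key2] at h
      have hag0 := hag 0 (by omega)
      rw [pow_zero, mul_one] at hag0
      have hag' : ∀ i < n, p.1 &&& (bit * 2 * 2 ^ i) = T &&& (bit * 2 * 2 ^ i) := by
        intro i hi
        have := hag (i + 1) (by omega)
        rwa [pow_succ, mul_comm (2 ^ i) 2, ← mul_assoc] at this
      rcases hT : T &&& bit with _ | m
      · rw [hT] at h hag0
        exact s1 T P h p (h2 p hp hag0) hag'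
      · rw [hT] at h hag0
        exact s2 T P h p (h3 p hp (by omega)) hag'

/-- a row of weight at most `kd` (no bound if `kd = 4`) with word `x` and weight `w` -/
def Mem (kd x w : ℕ) : Prop :=
  ∃ v : ℕ → ℕ, (∀ i, v i < 8) ∧ x = X v ∧ w = wt v ∧ (kd = 4 ∨ wt v ≤ kd)

def Good (t : Tr) (kd n : ℕ) : Prop :=
  ∀ T P, look T P t = true → ∀ x w, Mem kd x w → x &&& (2 ^ n - 1) = T → P x w = true

theorem Good.mono {t : Tr} {k k' n : ℕ} (h : Good t k' n) (hk : k ≤ k') (hk' : k' < 4) :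
    Good t k n := by
  intro T P hl x w ⟨v, h1, h2, h3, h4⟩ hx
  exact h T P hl x w ⟨v, h1, h2, h3, Or.inr (by omega)⟩ hx

/-! the value tables -/

theorem X_xor (v w : ℕ → ℕ) : X (fun i => v i ^^^ w i) = X v ^^^ X w := Xl_xor v w _

def linA : List ℕ := (List.range 7).map fun i => tabL tabA (2 ^ i)
def linB : List ℕ := (List.range 7).map fun i => tabL tabB (2 ^ i)
def linC : List ℕ := (List.range 7).map fun i => tabL tabC (2 ^ i)

theorem tabA_lin : ∀ c < 128, tabL tabA c = lin linA c := by decide +kernel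
theorem tabB_lin : ∀ c < 128, tabL tabB c = lin linB c := by decide +kernel
theorem tabC_lin : ∀ c < 128, tabL tabC c = lin linC c := by decide +kernel

theorem vals_eq (x : ℕ) : vals x = lin linA (x &&& 127) ^^^ (lin linB ((x >>> 7) &&& 127) ^^^
    lin linC ((x >>> 14) &&& 127)) := by
  have h : ∀ y : ℕ, y &&& 127 < 128 := fun y => by
    have := @Nat.and_le_right y 127; omega
  rw [← tabA_lin _ (h _), ← tabB_lin _ (h _), ← tabC_lin _ (h _)]; rfl

theorem vals_xor (x y : ℕ) : vals (x ^^^ y) = vals x ^^^ vals y := by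
  simp only [vals_eq, Nat.shiftRight_xor_distrib, Nat.and_xor_distrib_right, lin_xor]
  simp only [Nat.xor_assoc, Nat.xor_left_comm]

theorem vals_basis : ∀ i < 7, ∀ a < 8, vals (lin (basisR i) a &&& 2097151) = a <<< (3 * i) := by
  decide +kernel

theorem big_basis : ∀ i < 7, ∀ a < 8,
    lin bigTab (lin (basisR i) a &&& 2097151) = lin (basisR i) a := by
  decide +kernel

theorem vals_X (v : ℕ → ℕ) (hv : ∀ i, v i < 8) : vals (X v &&& 2097151) =
    v 0 ^^^ (v 1 <<< 3 ^^^ (v 2 <<< 6 ^^^ (v 3 <<< 9 ^^^ (v 4 <<< 12 ^^^ (v 5 <<< 15 ^^^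
      v 6 <<< 18))))) := by
  simp only [X, Xl, Nat.and_xor_distrib_right, vals_xor, Nat.zero_and]
  rw [vals_basis 0 (by omega) _ (hv _), vals_basis 1 (by omega) _ (hv _),
    vals_basis 2 (by omega) _ (hv _), vals_basis 3 (by omega) _ (hv _),
    vals_basis 4 (by omega) _ (hv _), vals_basis 5 (by omega) _ (hv _),
    vals_basis 6 (by omega) _ (hv _)]
  have : vals 0 = 0 := by decide +kernel
  simp [this]

theorem big_X (v : ℕ → ℕ) (hv : ∀ i, v i < 8) : lin bigTab (X v &&& 2097151) = X v := by
  simp only [X, Xl, Nat.and_xor_distrib_right, lin_xor, Nat.zero_and]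
  rw [big_basis 0 (by omega) _ (hv _), big_basis 1 (by omega) _ (hv _),
    big_basis 2 (by omega) _ (hv _), big_basis 3 (by omega) _ (hv _),
    big_basis 4 (by omega) _ (hv _), big_basis 5 (by omega) _ (hv _),
    big_basis 6 (by omega) _ (hv _)]
  simp [lin_zero]

theorem wtV_bits : ∀ b0 b1 b2 b3 b4 b5 b6 : Bool,
    ((b0.toNat + 8 * (b1.toNat + 8 * (b2.toNat + 8 * (b3.toNat + 8 * (b4.toNat + 8 * (b5.toNat +
      8 * b6.toNat)))))) * 299593) >>> 18 &&& 7 = b0.toNat + (b1.toNat + (b2.toNat + (b3.toNat +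
        (b4.toNat + (b5.toNat + b6.toNat))))) := by
  decide +kernel

/-- nonzero octal digits of `V`, masked by `M` -/
def oct (V M : ℕ) : ℕ := (V ||| V >>> 1 ||| V >>> 2) &&& M

theorem oct_step (a W M : ℕ) (ha : a < 8) :
    oct (a + 8 * W) (1 + 8 * M) = (decide (a ≠ 0)).toNat + 8 * oct W M := by
  have h1 : oct (a + 8 * W) (1 + 8 * M) >>> 3 = oct W M := by
    have e1 : (a + 8 * W) >>> 3 = W := by rw [Nat.shiftRight_eq_div_pow]; omega
    have e2 : (1 + 8 * M) >>> 3 = M := by rw [Nat.shiftRight_eq_div_pow]; omega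
    have e3 : ∀ n, ((a + 8 * W) >>> n) >>> 3 = W >>> n := by
      intro n
      rw [← Nat.shiftRight_add, add_comm n 3, Nat.shiftRight_add, e1]
    simp only [oct, Nat.shiftRight_and_distrib, Nat.shiftRight_or_distrib, e1, e2, e3]
  have h2 : oct (a + 8 * W) (1 + 8 * M) % 2 ^ 3 = (decide (a ≠ 0)).toNat := by
    have e2 : (1 + 8 * M) % 2 ^ 3 = 1 := by omega
    have e0 : (a + 8 * W) % 2 ^ 3 = a := by omega
    have e3 : (a + 8 * W) >>> 1 % 2 ^ 3 = (a / 2 + 4 * (W % 2)) := by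
      rw [Nat.shiftRight_eq_div_pow]; omega
    have e4 : (a + 8 * W) >>> 2 % 2 ^ 3 = (a / 4 + 2 * (W % 4)) := by
      rw [Nat.shiftRight_eq_div_pow]; omega
    rw [oct, Nat.and_mod_two_pow, Nat.or_mod_two_pow, Nat.or_mod_two_pow, e0, e2, e3, e4]
    have : W % 2 = W % 4 % 2 := by omega
    rw [this]
    have hw : W % 4 < 4 := by omega
    generalize W % 4 = w at hw
    revert hw ha
    revert a w
    have : ∀ a < 8, ∀ w < 4, (a ||| (a / 2 + 4 * (w % 2)) ||| (a / 4 + 2 * w)) &&& 1 =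
      (decide (a ≠ 0)).toNat := by decide
    intros; exact this _ ‹_› _ ‹_›
  rw [Nat.shiftRight_eq_div_pow] at h1
  have := Nat.div_add_mod (oct (a + 8 * W) (1 + 8 * M)) (2 ^ 3)
  omega

theorem xor_shl (a W : ℕ) (ha : a < 8) : a ^^^ W <<< 3 = a + 8 * W := by
  have h1 : (a ^^^ W <<< 3) >>> 3 = W := by
    rw [Nat.shiftRight_xor_distrib, Nat.shiftLeft_shiftRight,
      show a >>> 3 = 0 by rw [Nat.shiftRight_eq_div_pow]; omega, Nat.zero_xor]
  have h2 : (a ^^^ W <<< 3) % 2 ^ 3 = a := by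
    rw [Nat.xor_mod_two_pow, Nat.shiftLeft_eq, Nat.mul_mod_left, Nat.xor_zero]; omega
  rw [Nat.shiftRight_eq_div_pow] at h1
  have := Nat.div_add_mod (a ^^^ W <<< 3) (2 ^ 3)
  omega

theorem wt21_X (v : ℕ → ℕ) (hv : ∀ i, v i < 8) : wt21 (X v &&& 2097151) = wt v := by
  have h1 : vals (X v &&& 2097151) = v 0 + 8 * (v 1 + 8 * (v 2 + 8 * (v 3 + 8 * (v 4 + 8 * (v 5 +
      8 * (v 6 + 8 * 0)))))) := by
    rw [vals_X v hv]
    simp only [← xor_shl _ _ (hv _), Nat.shiftLeft_xor_distrib, ← Nat.shiftLeft_add,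
      Nat.zero_shiftLeft, Nat.xor_zero]
  have h2 : wtV (vals (X v &&& 2097151)) = (oct (vals (X v &&& 2097151))
    (1 + 8 * (1 + 8 * (1 + 8 * (1 + 8 * (1 + 8 * (1 + 8 * (1 + 8 * 0))))))) * 299593) >>> 18 &&& 7 := rfl
  rw [wt21, force_eq, h2, h1]
  simp only [oct_step _ _ _ (hv _)]
  have h3 : oct 0 0 = 0 := rfl
  rw [h3, mul_zero, add_zero, wtV_bits]
  simp only [wt, cnt]
  have : ∀ a : ℕ, (decide (a ≠ 0)).toNat = if a = 0 then 0 else 1 := by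
    intro a; by_cases h : a = 0 <;> simp [h]
  simp only [this, add_zero]

theorem and_bits {x T n : ℕ} (h : x &&& (2 ^ n - 1) = T) (i : ℕ) (hi : i < n) :
    x &&& (1 * 2 ^ i) = T &&& (1 * 2 ^ i) := by
  subst h
  apply Nat.eq_of_testBit_eq
  intro j
  simp only [one_mul, Nat.testBit_and, Nat.testBit_two_pow, Nat.testBit_two_pow_sub_one]
  by_cases hj : i = j
  · subst hj; simp [hi]
  · simp [hj]

theorem mkT_lt (kd n : ℕ) (hkd : kd < 4) (k : Tr → Bool) (h : mkT kd n k = true) :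
    ∃ t, Good t kd n ∧ k t = true := by
  have hb : Nat.beq kd 4 = false := by interval_cases kd <;> rfl
  rw [mkT, hb] at h
  change forceL (ws [0, 1, 2, 3, 4, 5, 6] kd) (fun l => buildK n 1 l k) [] = true at h
  obtain ⟨l, h1, h2, -⟩ := forceL_spec (ws [0, 1, 2, 3, 4, 5, 6] kd) (fun l => buildK n 1 l k) []
  rw [h1] at h
  obtain ⟨t, h3, h4⟩ := buildK_spec n 1 l k
  refine ⟨t, ?_, h3 ▸ h⟩
  rintro T P hl x w ⟨v, hv, rfl, rfl, hw⟩ hx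
  exact h4 T P hl (X v, wt v) (h2 _ (ws_mem v hv _ _ (by rcases hw with h | h; omega; exact h)))
    (fun i hi => and_bits hx i hi)

theorem mkT_four (k : Tr → Bool) (h : mkT 4 12 k = true) :
    ∃ t, Good t 4 12 ∧ k t = true := by
  change forceL hiL (fun l => k (Tr.zero l)) [] = true at h
  obtain ⟨l, h1, h2, -⟩ := forceL_spec hiL (fun l => k (Tr.zero l)) []
  rw [h1] at h
  refine ⟨Tr.zero l, ?_, h⟩
  rintro T P hl x w ⟨v, hv, rfl, rfl, hw⟩ hx
  change @Nat.rec (fun _ => Bool) (allL P l) (fun _ _ => false) T = true at hl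
  rcases T with _ | T
  · have hl' : allL P l = true := hl
    refine allL_spec P l hl' (X v, wt v) (h2 _ ?_)
    rw [hiL, List.mem_map]
    have e : X v &&& 2097151 = 4096 * (X v % 2097152 / 4096) := by
      have e1 : X v &&& (2 ^ 21 - 1) = X v % 2 ^ 21 := Nat.and_two_pow_sub_one_eq_mod _ _
      have e2 : X v &&& (2 ^ 12 - 1) = X v % 2 ^ 12 := Nat.and_two_pow_sub_one_eq_mod _ _
      rw [e2] at hx
      norm_num at e1 hx
      rw [e1]; omega
    refine ⟨X v % 2097152 / 4096, by rw [List.mem_range]; omega, ?_⟩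
    show (lin bigTab (4096 * _), wt21 (4096 * _)) = _
    rw [← e, big_X v hv, wt21_X v hv]
  · simp at hl

theorem search_sound {l0 : List (ℕ × ℕ)} {t1 t2 t3 t4 : Tr} {I : Inst} {k1 k2 k3 k4 : ℕ}
    (h : run l0 t1 t2 t3 t4 I = true) (g1 : Good t1 k1 3) (g2 : Good t2 k2 6) (g3 : Good t3 k3 9)
    (g4 : Good t4 k4 12) {x0 x1 x2 x3 x4 w0 w1 w2 w3 w4 : ℕ} (h0 : (x0, w0) ∈ l0)
    (h1 : Mem k1 x1 w1) (h2 : Mem k2 x2 w2) (h3 : Mem k3 x3 w3) (h4 : Mem k4 x4 w4)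
    (r1 : x1 &&& 7 = (fold3 (I.m0 &&& x0) >>> 315) &&& 7)
    (r2 : x2 &&& 63 = (fold3 ((I.m0 &&& x0) ^^^ (I.m1 &&& x1)) >>> 252) &&& 63)
    (r3 : x3 &&& 511 =
      (fold3 ((I.m0 &&& x0) ^^^ (I.m1 &&& x1) ^^^ (I.m2 &&& x2)) >>> 189) &&& 511)
    (r4 : x4 &&& 4095 = (fold3 ((I.m0 &&& x0) ^^^ (I.m1 &&& x1) ^^^ (I.m2 &&& x2) ^^^
      (I.m3 &&& x3)) >>> 126) &&& 4095) :
    finalOK ((I.m0 &&& x0) ^^^ (I.m1 &&& x1) ^^^ (I.m2 &&& x2) ^^^ (I.m3 &&& x3) ^^^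
      (I.m4 &&& x4)) (w0 + w1 + w2 + w3 + w4) = true := by
  simp only [run, force_eq] at h
  have a0 := allL_spec _ _ h _ h0
  simp only [lev1, force_eq] at a0
  have a1 := g1 _ _ a0 x1 w1 h1 r1
  simp only [lev2, force_eq] at a1
  have a2 := g2 _ _ a1 x2 w2 h2 r2
  simp only [lev3, force_eq] at a2
  have a3 := g3 _ _ a2 x3 w3 h3 r3
  simp only [lev4, force_eq] at a3
  exact g4 _ _ a3 x4 w4 h4 r4

theorem finalOK_sound {A acc : ℕ} (h : finalOK A acc = true) {v5 v6 : ℕ → ℕ}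
    (hv5 : ∀ i, v5 i < 8) (hv6 : ∀ i, v6 i < 8)
    (r5 : X v5 &&& 2097151 = (fold3 A >>> 63) &&& 2097151)
    (r6 : X v6 &&& 2097151 = fold3 A &&& 2097151) :
    acc + (wt v5 + wt v6) = 0 ∨ 16 ≤ acc + (wt v5 + wt v6) := by
  simp only [finalOK, force_eq, land_eq, shr_eq] at h
  rw [← r5, ← r6, wt21_X v5 hv5, wt21_X v6 hv6] at h
  rcases hb : Nat.ble 16 (acc + (wt v5 + wt v6)) with _ | _
  · left
    simp only [Nat.add_eq] at h
    rw [hb] at h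
    exact Nat.eq_of_beq_eq_true h
  · right; exact Nat.le_of_ble_eq_true hb

/-- the conclusion of a successful search -/
def Sound (I : Inst) : Prop :=
  ∀ x0 x1 x2 x3 x4 w0 w1 w2 w3 w4, (x0, w0) ∈ nrmL I.k0 →
    Mem I.k1 x1 w1 → Mem I.k2 x2 w2 → Mem I.k3 x3 w3 → Mem I.k4 x4 w4 →
    x1 &&& 7 = (fold3 (I.m0 &&& x0) >>> 315) &&& 7 →
    x2 &&& 63 = (fold3 ((I.m0 &&& x0) ^^^ (I.m1 &&& x1)) >>> 252) &&& 63 →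
    x3 &&& 511 = (fold3 ((I.m0 &&& x0) ^^^ (I.m1 &&& x1) ^^^ (I.m2 &&& x2)) >>> 189) &&& 511 →
    x4 &&& 4095 = (fold3 ((I.m0 &&& x0) ^^^ (I.m1 &&& x1) ^^^ (I.m2 &&& x2) ^^^
      (I.m3 &&& x3)) >>> 126) &&& 4095 →
    finalOK ((I.m0 &&& x0) ^^^ (I.m1 &&& x1) ^^^ (I.m2 &&& x2) ^^^ (I.m3 &&& x3) ^^^
      (I.m4 &&& x4)) (w0 + w1 + w2 + w3 + w4) = true

theorem allI_spec {P : Inst → Bool} (Is : List Inst)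
    (h : @List.rec Inst (fun _ => Bool) true (fun I _ ih => @Bool.rec (fun _ => Bool) false ih
        (P I)) Is = true) : ∀ I ∈ Is, P I = true := by
  induction Is with
  | nil => simp
  | cons I Is ih =>
    change @Bool.rec (fun _ => Bool) false (@List.rec Inst (fun _ => Bool) true
      (fun I _ ih => @Bool.rec (fun _ => Bool) false ih (P I)) Is) (P I) = true at h
    rcases hp : P I with _ | _
    · rw [hp] at h; exact absurd h (by simp)
    · rw [hp] at h
      intro q hq
      rcases List.mem_cons.mp hq with rfl | hq
      · exact hp
      · exact ih h _ hq

theorem batch_spec {k0 k1 k2 k3 k4 s n : ℕ} (hk1 : k1 < 4) (hk2 : k2 < 4) (hk3 : k3 < 4)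
    (hk4 : k4 < 4) {Is : List Inst} (h : batch k0 k1 k2 k3 k4 s n Is = true) :
    ∃ l0 t1 t2 t3 t4, (∀ p ∈ ((nrmL k0).drop s).take n, p ∈ l0) ∧ Good t1 k1 3 ∧ Good t2 k2 6 ∧
      Good t3 k3 9 ∧ Good t4 k4 12 ∧ ∀ I ∈ Is, run l0 t1 t2 t3 t4 I = true := by
  rw [batch] at h
  obtain ⟨l0, e0, m0, -⟩ := forceL_spec (((nrmL k0).drop s).take n)
    (fun l0 => mkT k1 3 (fun t1 => mkT k2 6 (fun t2 =>
    mkT k3 9 (fun t3 => mkT k4 12 (fun t4 =>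
      @List.rec Inst (fun _ => Bool) true (fun I _ ih => @Bool.rec (fun _ => Bool) false ih
        (run l0 t1 t2 t3 t4 I)) Is))))) []
  rw [e0] at h
  obtain ⟨t1, g1, h⟩ := mkT_lt _ _ hk1 _ h
  obtain ⟨t2, g2, h⟩ := mkT_lt _ _ hk2 _ h
  obtain ⟨t3, g3, h⟩ := mkT_lt _ _ hk3 _ h
  obtain ⟨t4, g4, h⟩ := mkT_lt _ _ hk4 _ h
  exact ⟨l0, t1, t2, t3, t4, m0, g1, g2, g3, g4, allI_spec Is h⟩

theorem soundB : ∀ I ∈ instB, Sound I := by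
  obtain ⟨l0, t1, t2, t3, t4, m0, g1, g2, g3, g4, hr⟩ :=
    batch_spec (by norm_num) (by norm_num) (by norm_num) (by norm_num) runB
  have hk : ∀ I ∈ instB, I.k0 = 2 ∧ I.k1 = 1 ∧ I.k2 = 2 ∧ I.k3 = 2 ∧ I.k4 = 2 := by
    decide +kernel
  intro I hI x0 x1 x2 x3 x4 w0 w1 w2 w3 w4 h0 h1 h2 h3 h4 r1 r2 r3 r4
  obtain ⟨e0, e1, e2, e3, e4⟩ := hk I hI
  rw [e0] at h0; rw [e1] at h1; rw [e2] at h2; rw [e3] at h3; rw [e4] at h4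
  have : (x0, w0) ∈ ((nrmL 2).drop 0).take 23 := by
    rwa [List.drop_zero, List.take_of_length_le (by decide +kernel)]
  exact search_sound (hr I hI) g1 g2 g3 g4 (m0 _ this) h1 h2 h3 h4 r1 r2 r3 r4

theorem soundC : ∀ I ∈ instC, Sound I := by
  have hk : ∀ I ∈ instC, I.k0 = 2 ∧ I.k1 = 2 ∧ I.k2 = 2 ∧ I.k3 = 2 ∧ I.k4 = 2 := by
    decide +kernel
  have key : ∀ s n, batch 2 2 2 2 2 s n instC = true → ∀ I ∈ instC,
      ∀ x0 x1 x2 x3 x4 w0 w1 w2 w3 w4, (x0, w0) ∈ ((nrmL 2).drop s).take n →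
    Mem I.k1 x1 w1 → Mem I.k2 x2 w2 → Mem I.k3 x3 w3 → Mem I.k4 x4 w4 →
    x1 &&& 7 = (fold3 (I.m0 &&& x0) >>> 315) &&& 7 →
    x2 &&& 63 = (fold3 ((I.m0 &&& x0) ^^^ (I.m1 &&& x1)) >>> 252) &&& 63 →
    x3 &&& 511 = (fold3 ((I.m0 &&& x0) ^^^ (I.m1 &&& x1) ^^^ (I.m2 &&& x2)) >>> 189) &&& 511 →
    x4 &&& 4095 = (fold3 ((I.m0 &&& x0) ^^^ (I.m1 &&& x1) ^^^ (I.m2 &&& x2) ^^^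
      (I.m3 &&& x3)) >>> 126) &&& 4095 →
    finalOK ((I.m0 &&& x0) ^^^ (I.m1 &&& x1) ^^^ (I.m2 &&& x2) ^^^ (I.m3 &&& x3) ^^^
      (I.m4 &&& x4)) (w0 + w1 + w2 + w3 + w4) = true := by
    intro s n hb I hI x0 x1 x2 x3 x4 w0 w1 w2 w3 w4 h0 h1 h2 h3 h4 r1 r2 r3 r4
    obtain ⟨l0, t1, t2, t3, t4, m0, g1, g2, g3, g4, hr⟩ :=
      batch_spec (by norm_num) (by norm_num) (by norm_num) (by norm_num) hb
    obtain ⟨e0, e1, e2, e3, e4⟩ := hk I hI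
    rw [e1] at h1; rw [e2] at h2; rw [e3] at h3; rw [e4] at h4
    exact search_sound (hr I hI) g1 g2 g3 g4 (m0 _ h0) h1 h2 h3 h4 r1 r2 r3 r4
  intro I hI x0 x1 x2 x3 x4 w0 w1 w2 w3 w4 h0
  rw [(hk I hI).1] at h0
  have e : nrmL 2 = ((nrmL 2).drop (6 * 0)).take 6 ++ (((nrmL 2).drop (6 * 1)).take 6 ++
      (((nrmL 2).drop (6 * 2)).take 6 ++ ((nrmL 2).drop (6 * 3)).take 6)) := by
    decide +kernel
  rw [e] at h0
  rcases List.mem_append.mp h0 with h0 | h0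
  · exact key _ _ runC0 I hI _ _ _ _ _ _ _ _ _ _ h0
  rcases List.mem_append.mp h0 with h0 | h0
  · exact key _ _ runC1 I hI _ _ _ _ _ _ _ _ _ _ h0
  rcases List.mem_append.mp h0 with h0 | h0
  · exact key _ _ runC2 I hI _ _ _ _ _ _ _ _ _ _ h0
  · exact key _ _ runC3 I hI _ _ _ _ _ _ _ _ _ _ h0

theorem mixed_spec {Is : List Inst} (h : mixed Is = true) :
    ∃ l1 l2 l3 a0 a1 b0 b1 b2 c2 c3 d2 d3 d4, (∀ p ∈ nrmL 1, p ∈ l1) ∧ (∀ p ∈ nrmL 2, p ∈ l2) ∧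
      (∀ p ∈ nrmL 3, p ∈ l3) ∧ Good a0 0 3 ∧ Good a1 1 3 ∧ Good b0 0 6 ∧ Good b1 1 6 ∧
      Good b2 2 6 ∧ Good c2 2 9 ∧ Good c3 3 9 ∧ Good d2 2 12 ∧ Good d3 3 12 ∧ Good d4 4 12 ∧
      ∀ I ∈ Is, run (sel (nrmL 0) l1 l2 l3 I.k0) (sel a0 a1 a1 a1 I.k1) (sel b0 b1 b2 b2 I.k2)
          (sel c2 c2 c2 c3 I.k3) (sel d2 d2 d2 (sel d3 d4 d4 d4 (Nat.sub I.k4 3)) I.k4) I = true := by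
  rw [mixed] at h
  obtain ⟨l1, e1, m1, -⟩ := forceL_spec (nrmL 1) (fun l1 => forceL (nrmL 2) (fun l2 =>
    forceL (nrmL 3) (fun l3 =>
  mkT 0 3 (fun a0 => mkT 1 3 (fun a1 => mkT 0 6 (fun b0 => mkT 1 6 (fun b1 => mkT 2 6 (fun b2 =>
  mkT 2 9 (fun c2 => mkT 3 9 (fun c3 => mkT 2 12 (fun d2 => mkT 3 12 (fun d3 => mkT 4 12 (fun d4 =>
      @List.rec Inst (fun _ => Bool) true (fun I _ ih => @Bool.rec (fun _ => Bool) false ih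
        (run (sel (nrmL 0) l1 l2 l3 I.k0) (sel a0 a1 a1 a1 I.k1) (sel b0 b1 b2 b2 I.k2)
          (sel c2 c2 c2 c3 I.k3) (sel d2 d2 d2 (sel d3 d4 d4 d4 (Nat.sub I.k4 3)) I.k4) I)) Is
  ))))))))))) []) []) []
  rw [e1] at h
  obtain ⟨l2, e2, m2, -⟩ := forceL_spec (nrmL 2) (fun l2 => forceL (nrmL 3) (fun l3 =>
  mkT 0 3 (fun a0 => mkT 1 3 (fun a1 => mkT 0 6 (fun b0 => mkT 1 6 (fun b1 => mkT 2 6 (fun b2 =>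
  mkT 2 9 (fun c2 => mkT 3 9 (fun c3 => mkT 2 12 (fun d2 => mkT 3 12 (fun d3 => mkT 4 12 (fun d4 =>
      @List.rec Inst (fun _ => Bool) true (fun I _ ih => @Bool.rec (fun _ => Bool) false ih
        (run (sel (nrmL 0) l1 l2 l3 I.k0) (sel a0 a1 a1 a1 I.k1) (sel b0 b1 b2 b2 I.k2)
          (sel c2 c2 c2 c3 I.k3) (sel d2 d2 d2 (sel d3 d4 d4 d4 (Nat.sub I.k4 3)) I.k4) I)) Is
  ))))))))))) []) []
  rw [e2] at h
  obtain ⟨l3, e3, m3, -⟩ := forceL_spec (nrmL 3) (fun l3 =>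
  mkT 0 3 (fun a0 => mkT 1 3 (fun a1 => mkT 0 6 (fun b0 => mkT 1 6 (fun b1 => mkT 2 6 (fun b2 =>
  mkT 2 9 (fun c2 => mkT 3 9 (fun c3 => mkT 2 12 (fun d2 => mkT 3 12 (fun d3 => mkT 4 12 (fun d4 =>
      @List.rec Inst (fun _ => Bool) true (fun I _ ih => @Bool.rec (fun _ => Bool) false ih
        (run (sel (nrmL 0) l1 l2 l3 I.k0) (sel a0 a1 a1 a1 I.k1) (sel b0 b1 b2 b2 I.k2)
          (sel c2 c2 c2 c3 I.k3) (sel d2 d2 d2 (sel d3 d4 d4 d4 (Nat.sub I.k4 3)) I.k4) I)) Is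
  ))))))))))) []
  rw [e3] at h
  clear e1 e2 e3
  obtain ⟨a0, ga0, h⟩ := mkT_lt _ _ (by norm_num) _ h
  obtain ⟨a1, ga1, h⟩ := mkT_lt _ _ (by norm_num) _ h
  obtain ⟨b0, gb0, h⟩ := mkT_lt _ _ (by norm_num) _ h
  obtain ⟨b1, gb1, h⟩ := mkT_lt _ _ (by norm_num) _ h
  obtain ⟨b2, gb2, h⟩ := mkT_lt _ _ (by norm_num) _ h
  obtain ⟨c2, gc2, h⟩ := mkT_lt _ _ (by norm_num) _ h
  obtain ⟨c3, gc3, h⟩ := mkT_lt _ _ (by norm_num) _ h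
  obtain ⟨d2, gd2, h⟩ := mkT_lt _ _ (by norm_num) _ h
  obtain ⟨d3, gd3, h⟩ := mkT_lt _ _ (by norm_num) _ h
  obtain ⟨d4, gd4, h⟩ := mkT_four _ h
  exact ⟨l1, l2, l3, a0, a1, b0, b1, b2, c2, c3, d2, d3, d4, m1, m2, m3, ga0, ga1, gb0, gb1, gb2,
    gc2, gc3, gd2, gd3, gd4, allI_spec Is h⟩

theorem soundA : ∀ I ∈ instA, Sound I := by
  obtain ⟨l1, l2, l3, a0, a1, b0, b1, b2, c2, c3, d2, d3, d4, m1, m2, m3, ga0, ga1, gb0, gb1, gb2,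
    gc2, gc3, gd2, gd3, gd4, hr⟩ := mixed_spec runA
  have hk : ∀ I ∈ instA, I.k0 < 4 ∧ I.k1 < 2 ∧ I.k2 < 3 ∧ I.k3 < 4 ∧ I.k4 < 5 := by
    decide +kernel
  intro I hI x0 x1 x2 x3 x4 w0 w1 w2 w3 w4 h0 h1 h2 h3 h4 r1 r2 r3 r4
  obtain ⟨b0', b1', b2', b3', b4'⟩ := hk I hI
  have hrI := hr I hI
  clear hr hk
  refine search_sound hrI (k1 := I.k1) (k2 := I.k2) (k3 := I.k3) (k4 := I.k4)
    ?_ ?_ ?_ ?_ ?_ h1 h2 h3 h4 r1 r2 r3 r4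
  · generalize I.k1 = k at b1'
    interval_cases k
    · exact ga0
    · exact ga1
  · generalize I.k2 = k at b2'
    interval_cases k
    · exact gb0
    · exact gb1
    · exact gb2
  · generalize I.k3 = k at b3'
    interval_cases k
    · exact gc2.mono (by norm_num) (by norm_num)
    · exact gc2.mono (by norm_num) (by norm_num)
    · exact gc2
    · exact gc3
  · generalize I.k4 = k at b4'
    interval_cases k
    · exact gd2.mono (by norm_num) (by norm_num)
    · exact gd2.mono (by norm_num) (by norm_num)
    · exact gd2
    · exact gd3
    · exact gd4
  · revert h0
    generalize I.k0 = k at b0'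
    intro h0
    interval_cases k
    · exact h0
    · exact m1 _ h0
    · exact m2 _ h0
    · exact m3 _ h0

def allI : List Inst := instA ++ (instB ++ instC)

theorem soundAll : ∀ I ∈ allI, Sound I := by
  intro I hI
  rcases List.mem_append.mp hI with h | h
  · exact soundA I h
  rcases List.mem_append.mp h with h | h
  · exact soundB I h
  · exact soundC I h

/-! ### The code over `{0, …, 7}` -/

/-- `ex n` encodes the power `ω ^ n` -/
def ex (n : ℕ) : ℕ := [1, 2, 4, 3, 6, 7, 5].getD (n % 7) 0

/-- the exponent vectors -/
def SL : List (ℕ × ℕ) := [(0, 4), (0, 5), (0, 6), (1, 2), (1, 3), (1, 4), (1, 5), (1, 6), (2, 1),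
  (2, 2), (2, 3), (2, 5), (2, 6), (3, 0), (3, 2), (3, 4), (3, 6), (4, 2), (4, 3), (4, 4), (4, 5),
  (5, 1), (5, 5), (6, 2), (6, 3)]

/-- encoded monomial codeword -/
def gen (s : ℕ × ℕ) (t j i : ℕ) : ℕ := ex (t + s.1 * (j + 4 * i) + s.2 * i)

inductive Code : (ℕ → ℕ → ℕ) → Prop
  | zero : Code (fun _ _ => 0)
  | gen (s : ℕ × ℕ) (hs : s ∈ SL) (t : ℕ) : Code (gen s t)
  | add {u v : ℕ → ℕ → ℕ} (hu : Code u) (hv : Code v) : Code (fun j i => u j i ^^^ v j i)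

theorem ex_mod (n : ℕ) : ex (n % 7) = ex n := by simp [ex]

theorem ex_congr {m n : ℕ} (h : m % 7 = n % 7) : ex m = ex n := by rw [← ex_mod m, h, ex_mod]

theorem ex_lt (n : ℕ) : ex n < 8 := by
  rw [← ex_mod]
  have h : n % 7 < 7 := Nat.mod_lt _ (by norm_num)
  generalize n % 7 = m at h
  revert m; decide

theorem ex_rec (n : ℕ) : ex (n + 3) = ex (n + 1) ^^^ ex n := by
  have h : n % 7 < 7 := Nat.mod_lt _ (by norm_num)
  rw [ex_congr (show (n + 3) % 7 = (n % 7 + 3) % 7 by omega),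
    ex_congr (show (n + 1) % 7 = (n % 7 + 1) % 7 by omega), ← ex_mod n]
  generalize n % 7 = m at h
  revert m; decide

/-- multiplication by `ω` -/
noncomputable def scl (a : ℕ) : ℕ := lin [2, 4, 3] a

theorem scl_ex (n : ℕ) : scl (ex n) = ex (n + 1) := by
  have h : n % 7 < 7 := Nat.mod_lt _ (by norm_num)
  rw [ex_congr (show (n + 1) % 7 = (n % 7 + 1) % 7 by omega), ← ex_mod n]
  generalize n % 7 = m at h
  revert m; decide +kernel

theorem Code.lt {u : ℕ → ℕ → ℕ} (h : Code u) (j i : ℕ) : u j i < 8 := by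
  induction h with
  | zero => norm_num
  | gen s hs t => exact ex_lt _
  | add hu hv h1 h2 => exact Nat.xor_lt_two_pow (n := 3) h1 h2

theorem Code.perJ {u : ℕ → ℕ → ℕ} (h : Code u) (j i : ℕ) : u (j + 7) i = u j i := by
  induction h with
  | zero => rfl
  | gen s hs t =>
    apply ex_congr
    rw [show t + s.1 * (j + 7 + 4 * i) + s.2 * i = t + s.1 * (j + 4 * i) + s.2 * i + 7 * s.1 by ring,
      Nat.add_mul_mod_self_left]
  | add hu hv h1 h2 => simp only [h1, h2]

theorem Code.perI {u : ℕ → ℕ → ℕ} (h : Code u) (j i : ℕ) : u j (i + 7) = u j i := by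
  induction h with
  | zero => rfl
  | gen s hs t =>
    apply ex_congr
    rw [show t + s.1 * (j + 4 * (i + 7)) + s.2 * (i + 7) =
      t + s.1 * (j + 4 * i) + s.2 * i + 7 * (4 * s.1 + s.2) by ring,
      Nat.add_mul_mod_self_left]
  | add hu hv h1 h2 => simp only [h1, h2]

theorem Code.shiftJ {u : ℕ → ℕ → ℕ} (h : Code u) (r : ℕ) : Code (fun j i => u (j + r) i) := by
  induction h with
  | zero => exact Code.zero
  | gen s hs t =>
    have e : (fun j i => _root_.gen s t (j + r) i) = _root_.gen s (t + s.1 * r) := by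
      funext j i
      exact congrArg ex (by ring)
    rw [e]; exact Code.gen s hs _
  | add hu hv h1 h2 => exact Code.add h1 h2

theorem Code.shiftI {u : ℕ → ℕ → ℕ} (h : Code u) (r : ℕ) : Code (fun j i => u j (i + r)) := by
  induction h with
  | zero => exact Code.zero
  | gen s hs t =>
    have e : (fun j i => _root_.gen s t j (i + r)) = _root_.gen s (t + 4 * s.1 * r + s.2 * r) := by
      funext j i
      exact congrArg ex (by ring)
    rw [e]; exact Code.gen s hs _
  | add hu hv h1 h2 => exact Code.add h1 h2

theorem Code.scale {u : ℕ → ℕ → ℕ} (h : Code u) : Code (fun j i => scl (u j i)) := by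
  induction h with
  | zero => simp only [scl, lin_zero]; exact Code.zero
  | gen s hs t =>
    have e : (fun j i => scl (_root_.gen s t j i)) = _root_.gen s (t + 1) := by
      funext j i
      exact (scl_ex _).trans (congrArg ex (by ring))
    rw [e]; exact Code.gen s hs _
  | add hu hv h1 h2 =>
    simp only [scl, lin_xor]
    exact Code.add h1 h2

theorem Code.scales {u : ℕ → ℕ → ℕ} (h : Code u) (a : ℕ) :
    Code (fun j i => scl^[a] (u j i)) := by
  induction a with
  | zero => exact h
  | succ a ih => simp only [Function.iterate_succ_apply']; exact ih.scale

/-! residual equations -/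

/-- the linear relations used by the search -/
def ResOK (I : Inst) (x0 x1 x2 x3 x4 x5 x6 : ℕ) : Prop :=
  x1 &&& 7 = (fold3 (I.m0 &&& x0) >>> 315) &&& 7 ∧
  x2 &&& 63 = (fold3 ((I.m0 &&& x0) ^^^ (I.m1 &&& x1)) >>> 252) &&& 63 ∧
  x3 &&& 511 = (fold3 ((I.m0 &&& x0) ^^^ (I.m1 &&& x1) ^^^ (I.m2 &&& x2)) >>> 189) &&& 511 ∧
  x4 &&& 4095 = (fold3 ((I.m0 &&& x0) ^^^ (I.m1 &&& x1) ^^^ (I.m2 &&& x2) ^^^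
      (I.m3 &&& x3)) >>> 126) &&& 4095 ∧
  x5 &&& 2097151 = (fold3 ((I.m0 &&& x0) ^^^ (I.m1 &&& x1) ^^^ (I.m2 &&& x2) ^^^
      (I.m3 &&& x3) ^^^ (I.m4 &&& x4)) >>> 63) &&& 2097151 ∧
  x6 &&& 2097151 = fold3 ((I.m0 &&& x0) ^^^ (I.m1 &&& x1) ^^^ (I.m2 &&& x2) ^^^
      (I.m3 &&& x3) ^^^ (I.m4 &&& x4)) &&& 2097151

theorem fold3_xor (x y : ℕ) : fold3 (x ^^^ y) = fold3 x ^^^ fold3 y := by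
  simp only [fold3, xor_eq, shr_eq, Nat.shiftRight_xor_distrib]
  simp only [Nat.xor_assoc, Nat.xor_left_comm]

theorem acc_xor (A B m x y : ℕ) :
    (A ^^^ B) ^^^ (m &&& (x ^^^ y)) = (A ^^^ (m &&& x)) ^^^ (B ^^^ (m &&& y)) := by
  rw [Nat.and_xor_distrib_left]
  simp only [Nat.xor_assoc, Nat.xor_left_comm]

theorem res_xor {a b A B s M : ℕ} (h : a &&& M = (fold3 A >>> s) &&& M)
    (h' : b &&& M = (fold3 B >>> s) &&& M) :
    (a ^^^ b) &&& M = (fold3 (A ^^^ B) >>> s) &&& M := by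
  rw [fold3_xor, Nat.shiftRight_xor_distrib, Nat.and_xor_distrib_right, Nat.and_xor_distrib_right,
    h, h']

theorem ResOK.xor {I : Inst} {x0 x1 x2 x3 x4 x5 x6 y0 y1 y2 y3 y4 y5 y6 : ℕ}
    (h : ResOK I x0 x1 x2 x3 x4 x5 x6) (h' : ResOK I y0 y1 y2 y3 y4 y5 y6) :
    ResOK I (x0 ^^^ y0) (x1 ^^^ y1) (x2 ^^^ y2) (x3 ^^^ y3) (x4 ^^^ y4) (x5 ^^^ y5)
      (x6 ^^^ y6) := by
  obtain ⟨a1, a2, a3, a4, a5, a6⟩ := h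
  obtain ⟨b1, b2, b3, b4, b5, b6⟩ := h'
  have e0 : I.m0 &&& (x0 ^^^ y0) = (I.m0 &&& x0) ^^^ (I.m0 &&& y0) := Nat.and_xor_distrib_left
  refine ⟨?_, ?_, ?_, ?_, ?_, ?_⟩
  · rw [e0]; exact res_xor a1 b1
  · rw [e0, acc_xor _ _ I.m1]; exact res_xor a2 b2
  · rw [e0, acc_xor _ _ I.m1, acc_xor _ _ I.m2]; exact res_xor a3 b3
  · rw [e0, acc_xor _ _ I.m1, acc_xor _ _ I.m2, acc_xor _ _ I.m3]; exact res_xor a4 b4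
  · rw [e0, acc_xor _ _ I.m1, acc_xor _ _ I.m2, acc_xor _ _ I.m3, acc_xor _ _ I.m4]; exact res_xor a5 b5
  · rw [e0, acc_xor _ _ I.m1, acc_xor _ _ I.m2, acc_xor _ _ I.m3, acc_xor _ _ I.m4]; exact res_xor (s := 0) a6 b6

/-- list lookup -/
noncomputable def nth (l : List ℕ) : ℕ → ℕ :=
  @List.rec ℕ (fun _ => ℕ → ℕ) (fun _ => 0)
    (fun a _ ih p => @Nat.rec (fun _ => ℕ) a (fun p _ => ih p) p) l

noncomputable def chkI (l : List ℕ) (I : Inst) : Bool :=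
  force (nth l I.p0) fun x0 => force (nth l I.p1) fun x1 => force (nth l I.p2) fun x2 =>
  force (nth l I.p3) fun x3 => force (nth l I.p4) fun x4 =>
  force (Nat.land I.m0 x0) fun A0 =>
  force (Nat.xor A0 (Nat.land I.m1 x1)) fun A1 =>
  force (Nat.xor A1 (Nat.land I.m2 x2)) fun A2 =>
  force (Nat.xor A2 (Nat.land I.m3 x3)) fun A3 =>
  force (fold3 (Nat.xor A3 (Nat.land I.m4 x4))) fun F =>
  (Nat.beq (Nat.land x1 7) (Nat.land (Nat.shiftRight (fold3 A0) 315) 7)).and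
  ((Nat.beq (Nat.land x2 63) (Nat.land (Nat.shiftRight (fold3 A1) 252) 63)).and
  ((Nat.beq (Nat.land x3 511) (Nat.land (Nat.shiftRight (fold3 A2) 189) 511)).and
  ((Nat.beq (Nat.land x4 4095) (Nat.land (Nat.shiftRight (fold3 A3) 126) 4095)).and
  ((Nat.beq (Nat.land (nth l I.p5) 2097151) (Nat.land (Nat.shiftRight F 63) 2097151)).and
  (Nat.beq (Nat.land (nth l I.p6) 2097151) (Nat.land F 2097151))))))

theorem chkI_spec {l : List ℕ} {I : Inst} (h : chkI l I = true) :
    ResOK I (nth l I.p0) (nth l I.p1) (nth l I.p2) (nth l I.p3) (nth l I.p4) (nth l I.p5)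
      (nth l I.p6) := by
  simp only [chkI, force_eq, Bool.and_eq_true] at h
  obtain ⟨a1, a2, a3, a4, a5, a6⟩ := h
  exact ⟨Nat.eq_of_beq_eq_true a1, Nat.eq_of_beq_eq_true a2, Nat.eq_of_beq_eq_true a3,
    Nat.eq_of_beq_eq_true a4, Nat.eq_of_beq_eq_true a5, Nat.eq_of_beq_eq_true a6⟩

/-- check the relations on one generator -/
noncomputable def chkG (s : ℕ × ℕ) (t : ℕ) : Bool :=
  force (X (gen s t 0)) fun y0 => force (X (gen s t 1)) fun y1 => force (X (gen s t 2)) fun y2 =>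
  force (X (gen s t 3)) fun y3 => force (X (gen s t 4)) fun y4 => force (X (gen s t 5)) fun y5 =>
  force (X (gen s t 6)) fun y6 => allI.all (chkI [y0, y1, y2, y3, y4, y5, y6])

theorem chkG_all : SL.all (fun s => (chkG s 0).and ((chkG s 1).and (chkG s 2))) = true := by
  decide +kernel

def permI (I : Inst) : Prop :=
  [I.p0, I.p1, I.p2, I.p3, I.p4, I.p5, I.p6].Perm [0, 1, 2, 3, 4, 5, 6]

instance (I : Inst) : Decidable (permI I) := by unfold permI; infer_instance

theorem perm_all : ∀ I ∈ allI, permI I := by decide +kernel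

theorem lt_of_permI {I : Inst} (h : permI I) : I.p0 < 7 ∧ I.p1 < 7 ∧ I.p2 < 7 ∧ I.p3 < 7 ∧
    I.p4 < 7 ∧ I.p5 < 7 ∧ I.p6 < 7 := by
  have key : ∀ p ∈ [I.p0, I.p1, I.p2, I.p3, I.p4, I.p5, I.p6], p < 7 := by
    intro p hp
    have := h.mem_iff.mp hp
    simp at this; omega
  simpa using key

/-- the relations hold for `u` -/
def ResU (I : Inst) (u : ℕ → ℕ → ℕ) : Prop :=
  ResOK I (X (u I.p0)) (X (u I.p1)) (X (u I.p2)) (X (u I.p3)) (X (u I.p4)) (X (u I.p5)) (X (u I.p6))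

theorem chkG_spec {s : ℕ × ℕ} {t : ℕ} (h : chkG s t = true) {I : Inst} (hI : I ∈ allI) :
    ResU I (gen s t) := by
  simp only [chkG, force_eq, List.all_eq_true] at h
  have h1 := chkI_spec (h I hI)
  obtain ⟨h2, h3, h4, h5, h6, h7, h8⟩ := lt_of_permI (perm_all I hI)
  have key : ∀ p < 7, nth [X (gen s t 0), X (gen s t 1), X (gen s t 2), X (gen s t 3),
    X (gen s t 4), X (gen s t 5), X (gen s t 6)] p = X (gen s t p) := by
    intro p hp
    interval_cases p <;> rfl
  rwa [key _ h2, key _ h3, key _ h4, key _ h5, key _ h6, key _ h7, key _ h8] at h1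

theorem ResU.xor {I : Inst} {u v : ℕ → ℕ → ℕ} (hu : ResU I u) (hv : ResU I v) :
    ResU I (fun j i => u j i ^^^ v j i) := by
  have := ResOK.xor hu hv
  simpa only [ResU, X_xor] using this

theorem gen_res {I : Inst} (hI : I ∈ allI) {s : ℕ × ℕ} (hs : s ∈ SL) (t : ℕ) :
    ResU I (gen s t) := by
  have h := chkG_all
  rw [List.all_eq_true] at h
  have := h s hs
  simp only [Bool.and_eq_true] at this
  obtain ⟨c0, c1, c2⟩ := this
  induction t using Nat.strong_induction_on with
  | _ t ih =>
    by_cases ht : t < 3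
    · interval_cases t
      · exact chkG_spec c0 hI
      · exact chkG_spec c1 hI
      · exact chkG_spec c2 hI
    · obtain ⟨m, rfl⟩ : ∃ m, t = m + 3 := ⟨t - 3, by omega⟩
      have := (ih (m + 1) (by omega)).xor (ih m (by omega))
      convert this using 3
      rename_i j i
      simp only [gen]
      rw [show m + 3 + s.1 * (j + 4 * i) + s.2 * i = m + s.1 * (j + 4 * i) + s.2 * i + 3 by ring,
        show m + 1 + s.1 * (j + 4 * i) + s.2 * i = m + s.1 * (j + 4 * i) + s.2 * i + 1 by ring,
        ex_rec]

theorem Code.res {u : ℕ → ℕ → ℕ} (h : Code u) {I : Inst} (hI : I ∈ allI) : ResU I u := by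
  induction h with
  | zero =>
    have h1 := gen_res hI (show (0, 4) ∈ SL by decide) 0
    have h2 := h1.xor h1
    simpa only [Nat.xor_self] using h2
  | gen s hs t => exact gen_res hI hs t
  | add hu hv h1 h2 => exact h1.xor h2

/-! ### Every light weight distribution is covered by an instance -/

/-- bit set of the entries of a list satisfying a predicate -/
noncomputable def mk {α : Type} (P : α → Bool) (l : List α) : ℕ :=
  @List.rec α (fun _ => ℕ) 0 (fun c _ ih => Nat.add (Bool.toNat (P c)) (Nat.mul 2 ih)) l

theorem mk_spec {α : Type} (P : α → Bool) (l : List α) (i : ℕ) (h : (mk P l).testBit i = true) :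
    ∃ c, l[i]? = some c ∧ P c = true := by
  induction l generalizing i with
  | nil => exact absurd h (by simp [mk])
  | cons c l ih =>
    have e : mk P (c :: l) = (P c).toNat + 2 * mk P l := rfl
    rw [e] at h
    cases i with
    | zero =>
      refine ⟨c, by simp, ?_⟩
      rcases hp : P c with _ | _
      · rw [hp] at h; simp at h
      · rfl
    | succ i =>
      rw [Nat.testBit_succ] at h
      have : ((P c).toNat + 2 * mk P l) / 2 = mk P l := by
        have := Bool.toNat_lt (P c); omega
      rw [this] at h
      simpa using ih i h

noncomputable def limL (j a p k r : ℕ) : Bool :=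
  ((Nat.beq (Nat.mod (Nat.add p r) 7) j).not).or (Nat.ble a k)

/-- instance `c.1` rotated by `c.2` allows weight `a` (capped at 4) in row `j` -/
noncomputable def allow (j a : ℕ) (c : Inst × ℕ) : Bool :=
  (limL j a c.1.p0 c.1.k0 c.2).and ((limL j a c.1.p1 c.1.k1 c.2).and
    ((limL j a c.1.p2 c.1.k2 c.2).and ((limL j a c.1.p3 c.1.k3 c.2).and
      (limL j a c.1.p4 c.1.k4 c.2))))

def cands : List (Inst × ℕ) :=
  allI.flatMap fun I => [(I, 0), (I, 1), (I, 2), (I, 3), (I, 4), (I, 5), (I, 6)]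

noncomputable def forceN {α : Type} (l : List ℕ) (k : List ℕ → α) : List ℕ → α :=
  @List.rec ℕ (fun _ => List ℕ → α) k
    (fun p _ ih acc => force p (fun x => ih (x :: acc))) l

theorem forceN_eq {α : Type} (l : List ℕ) (k : List ℕ → α) (acc : List ℕ) :
    forceN l k acc = k (l.reverse ++ acc) := by
  induction l generalizing acc with
  | nil => rfl
  | cons p l ih =>
    change force p (fun x => forceN l k (x :: acc)) = _
    rw [force_eq, ih]; simp

noncomputable def inner (ih : ℕ → ℕ → Bool) (cur : ℕ) (b : List ℕ) : ℕ → Bool :=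
  @List.rec ℕ (fun _ => ℕ → Bool) (fun _ => true)
    (fun m _ ih2 bud => (force (Nat.land cur m) (ih bud)).and
      (@Nat.rec (fun _ => Bool) true (fun p _ => ih2 p) bud)) b

noncomputable def dfs (LL : List (List ℕ)) : ℕ → ℕ → Bool :=
  @List.rec (List ℕ) (fun _ => ℕ → ℕ → Bool) (fun _ cur => (Nat.beq (Nat.shiftRight cur 21) 0).not)
    (fun b _ ih bud cur => inner ih cur b bud) LL

theorem inner_spec {ih : ℕ → ℕ → Bool} {cur : ℕ} (b : List ℕ) (bud : ℕ)
    (h : inner ih cur b bud = true) (a m : ℕ) (hm : b[a]? = some m) (ha : a ≤ bud) :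
    ih (bud - a) (cur &&& m) = true := by
  induction b generalizing bud a with
  | nil => simp at hm
  | cons m0 b ih2 =>
    change (force (cur &&& m0) (ih bud)).and
      (@Nat.rec (fun _ => Bool) true (fun p _ => inner ih cur b p) bud) = true at h
    rw [force_eq, Bool.and_eq_true] at h
    cases a with
    | zero =>
      simp at hm; subst hm
      exact h.1
    | succ a =>
      obtain ⟨p, rfl⟩ : ∃ p, bud = p + 1 := ⟨bud - 1, by omega⟩
      have := ih2 p h.2 a (by simpa using hm) (by omega)
      rwa [show p + 1 - (a + 1) = p - a by omega]

theorem dfs_spec (LL : List (List ℕ)) : ∀ (bud cur : ℕ), dfs LL bud cur = true →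
    ∀ ams : List (ℕ × ℕ), List.Forall₂ (fun b (am : ℕ × ℕ) => b[am.1]? = some am.2) LL ams →
      (ams.map Prod.fst).sum ≤ bud → ams.foldl (fun c am => c &&& am.2) cur >>> 21 ≠ 0 := by
  induction LL with
  | nil =>
    intro bud cur h ams hf _
    cases hf
    intro h0
    simp only [List.foldl_nil] at h0
    change (Nat.beq (cur >>> 21) 0).not = true at h
    rw [h0] at h
    exact absurd h (by decide)
  | cons b LL ih =>
    intro bud cur h ams hf hs
    cases hf with
    | cons h1 h2 =>
      rename_i am ams
      simp only [List.map_cons, List.sum_cons] at hs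
      have := inner_spec b bud h am.1 am.2 h1 (by omega)
      exact ih _ _ this ams h2 (by omega)

/-- the bit set of the allowing candidates, preceded by a code of `(j, a)` -/
noncomputable def mkC (j a : ℕ) : ℕ :=
  Nat.add (Nat.sub 2097151 (Nat.mul (Nat.sub 6 a) (Nat.pow 8 j)))
    (Nat.mul 2097152 (mk (allow j a) cands))

theorem mkC_testBit (j a i : ℕ) : (mkC j a).testBit (21 + i) = (mk (allow j a) cands).testBit i := by
  have h : mkC j a = (2097151 - (6 - a) * 8 ^ j) + 2097152 * mk (allow j a) cands := rfl
  rw [h, add_comm 21 i, Nat.testBit_add, show (2097151 - (6 - a) * 8 ^ j +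
    2097152 * mk (allow j a) cands) / 2 ^ 21 = mk (allow j a) cands by omega]

noncomputable def masksR (j : ℕ) : List ℕ :=
  [mkC j 4, mkC j 3, mkC j 2, mkC j 1, mkC j 0]

noncomputable def cover : Bool :=
  forceN (masksR 0) (fun b0 => forceN (masksR 1) (fun b1 => forceN (masksR 2) (fun b2 =>
  forceN (masksR 3) (fun b3 => forceN (masksR 4) (fun b4 => forceN (masksR 5) (fun b5 =>
  forceN (masksR 6) (fun b6 =>
    dfs [b0, b1, b2, b3, b4, b5, b6] 15 (Nat.sub (Nat.pow 2 861) 1)) []) []) []) []) []) []) []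

theorem cover_true : cover = true := by decide +kernel

theorem dfs_seven (f : ℕ → ℕ → ℕ) {bud cur : ℕ}
    (h : dfs [[f 0 4, f 0 3, f 0 2, f 0 1, f 0 0].reverse,
      [f 1 4, f 1 3, f 1 2, f 1 1, f 1 0].reverse,
      [f 2 4, f 2 3, f 2 2, f 2 1, f 2 0].reverse,
      [f 3 4, f 3 3, f 3 2, f 3 1, f 3 0].reverse,
      [f 4 4, f 4 3, f 4 2, f 4 1, f 4 0].reverse,
      [f 5 4, f 5 3, f 5 2, f 5 1, f 5 0].reverse,
      [f 6 4, f 6 3, f 6 2, f 6 1, f 6 0].reverse] bud cur = true)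
    (a : ℕ → ℕ) (ha : ∀ j, a j < 5) (hs : a 0 + a 1 + a 2 + a 3 + a 4 + a 5 + a 6 ≤ bud) :
    (cur &&& f 0 (a 0) &&& f 1 (a 1) &&& f 2 (a 2) &&& f 3 (a 3) &&& f 4 (a 4) &&& f 5 (a 5) &&&
      f 6 (a 6)) >>> 21 ≠ 0 := by
  have key : ∀ j, [f j 4, f j 3, f j 2, f j 1, f j 0].reverse[a j]? = some (f j (a j)) := by
    intro j
    have := ha j
    generalize a j = b at this
    interval_cases b <;> rfl
  exact dfs_spec _ _ _ h [(a 0, f 0 (a 0)), (a 1, f 1 (a 1)), (a 2, f 2 (a 2)), (a 3, f 3 (a 3)),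
      (a 4, f 4 (a 4)), (a 5, f 5 (a 5)), (a 6, f 6 (a 6))]
    (List.Forall₂.cons (key 0) (List.Forall₂.cons (key 1) (List.Forall₂.cons (key 2)
        (List.Forall₂.cons (key 3) (List.Forall₂.cons (key 4) (List.Forall₂.cons (key 5)
        (List.Forall₂.cons (key 6) List.Forall₂.nil)))))))
    (by simp only [List.map_cons, List.map_nil, List.sum_cons, List.sum_nil]; omega)

theorem coverage (w : ℕ → ℕ) (hw : w 0 + w 1 + w 2 + w 3 + w 4 + w 5 + w 6 ≤ 15) :
    ∃ I ∈ allI, ∃ r, ∀ j < 7, allow j (min (w j) 4) (I, r) = true := by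
  have h := cover_true
  simp only [cover, forceN_eq, List.append_nil, masksR] at h
  have h2 := dfs_seven mkC h (fun j => min (w j) 4) (fun j => by omega) (by omega)
  obtain ⟨i, hi⟩ := Nat.exists_testBit_of_ne_zero h2
  simp only [Nat.testBit_shiftRight, Nat.testBit_and, Bool.and_eq_true, mkC_testBit] at hi
  obtain ⟨⟨⟨⟨⟨⟨⟨-, i0⟩, i1⟩, i2⟩, i3⟩, i4⟩, i5⟩, i6⟩ := hi
  obtain ⟨c, hc, c0⟩ := mk_spec _ _ _ i0
  have nxt : ∀ j a, (mk (allow j a) cands).testBit i = true → allow j a c = true := by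
    intro j a hj
    obtain ⟨c', hc', c0'⟩ := mk_spec _ _ _ hj
    rw [hc] at hc'
    cases hc'
    exact c0'
  have hmem : c ∈ cands := List.mem_of_getElem? hc
  obtain ⟨I, hI, hcI⟩ := List.mem_flatMap.mp hmem
  have hc1 : c.1 = I := by
    simp only [List.mem_cons, List.not_mem_nil, or_false] at hcI
    rcases hcI with rfl | rfl | rfl | rfl | rfl | rfl | rfl <;> rfl
  refine ⟨I, hI, c.2, ?_⟩
  subst hc1
  intro j hj
  interval_cases j
  · exact nxt _ _ i0
  · exact nxt _ _ i1
  · exact nxt _ _ i2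
  · exact nxt _ _ i3
  · exact nxt _ _ i4
  · exact nxt _ _ i5
  · exact nxt _ _ i6

theorem kinds_all : ∀ I ∈ allI, I.k0 < 4 ∧ I.k1 ≤ 4 ∧ I.k2 ≤ 4 ∧ I.k3 ≤ 4 ∧ I.k4 ≤ 4 := by
  decide +kernel

theorem limL_spec {w : ℕ → ℕ} {p k r : ℕ} (h : limL ((p + r) % 7) (min (w ((p + r) % 7)) 4) p k r = true)
    (hk : k ≤ 4) : k = 4 ∨ w ((p + r) % 7) ≤ k := by
  simp only [limL, Bool.or_eq_true] at h
  rcases h with h | h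
  · have : Nat.beq ((p + r) % 7) ((p + r) % 7) = true := Nat.beq_refl _
    change (!(Nat.beq ((p + r) % 7) ((p + r) % 7))) = true at h
    rw [this] at h; exact absurd h (by simp)
  · have := Nat.le_of_ble_eq_true h
    omega

theorem coverage2 (w : ℕ → ℕ) (hw : w 0 + w 1 + w 2 + w 3 + w 4 + w 5 + w 6 ≤ 15) :
    ∃ I ∈ allI, ∃ r, (w ((I.p0 + r) % 7) ≤ I.k0) ∧ (I.k1 = 4 ∨ w ((I.p1 + r) % 7) ≤ I.k1) ∧
      (I.k2 = 4 ∨ w ((I.p2 + r) % 7) ≤ I.k2) ∧ (I.k3 = 4 ∨ w ((I.p3 + r) % 7) ≤ I.k3) ∧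
      (I.k4 = 4 ∨ w ((I.p4 + r) % 7) ≤ I.k4) := by
  obtain ⟨I, hI, r, h⟩ := coverage w hw
  obtain ⟨q0, q1, q2, q3, q4⟩ := kinds_all I hI
  have hl : ∀ p, (p + r) % 7 < 7 := fun p => Nat.mod_lt _ (by norm_num)
  have h0 := h _ (hl I.p0)
  have h1 := h _ (hl I.p1)
  have h2 := h _ (hl I.p2)
  have h3 := h _ (hl I.p3)
  have h4 := h _ (hl I.p4)
  simp only [allow, Bool.and_eq_true] at h0 h1 h2 h3 h4
  have e0 := limL_spec h0.1 q0.le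
  exact ⟨I, hI, r, by omega, limL_spec h1.2.1 q1, limL_spec h2.2.2.1 q2, limL_spec h3.2.2.2.1 q3,
    limL_spec h4.2.2.2.2 q4⟩

/-! ### Normalisation and the combinatorial theorem -/

theorem cnt_congr {v w : ℕ → ℕ} {is : List ℕ} (h : ∀ i ∈ is, (v i = 0 ↔ w i = 0)) :
    cnt v is = cnt w is := by
  induction is with
  | nil => rfl
  | cons i is ih =>
    simp only [cnt]
    rw [ih (fun j hj => h j (List.mem_cons_of_mem _ hj))]
    simp only [h i List.mem_cons_self]

theorem sum_rot (w : ℕ → ℕ) (hw : ∀ i, w (i + 7) = w i) (r : ℕ) :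
    w (0 + r) + w (1 + r) + w (2 + r) + w (3 + r) + w (4 + r) + w (5 + r) + w (6 + r) =
      w 0 + w 1 + w 2 + w 3 + w 4 + w 5 + w 6 := by
  induction r with
  | zero => rfl
  | succ r ih =>
    rw [← ih]
    have := hw r
    rw [show 6 + (r + 1) = r + 7 by omega, this, show 0 + (r + 1) = 1 + r by omega,
      show 1 + (r + 1) = 2 + r by omega, show 2 + (r + 1) = 3 + r by omega,
      show 3 + (r + 1) = 4 + r by omega, show 4 + (r + 1) = 5 + r by omega,
      show 5 + (r + 1) = 6 + r by omega, show 0 + r = r by omega]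
    omega

theorem wt_shift (v : ℕ → ℕ) (hv : ∀ i, v (i + 7) = v i) (c : ℕ) :
    wt (fun i => v (i + c)) = wt v := by
  have h := sum_rot (fun i => if v i = 0 then 0 else 1) (fun i => by simp only [hv]) c
  have e : ∀ v : ℕ → ℕ, wt v = (if v 0 = 0 then 0 else 1) + (if v 1 = 0 then 0 else 1) +
      (if v 2 = 0 then 0 else 1) + (if v 3 = 0 then 0 else 1) + (if v 4 = 0 then 0 else 1) +
      (if v 5 = 0 then 0 else 1) + (if v 6 = 0 then 0 else 1) := by
    intro v
    simp only [wt, cnt]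
    omega
  rw [e, e]
  exact h

theorem scl_facts : ∀ a < 8, scl a < 8 ∧ (scl a = 0 ↔ a = 0) := by decide +kernel

theorem scls_facts (n : ℕ) : ∀ a < 8, scl^[n] a < 8 ∧ (scl^[n] a = 0 ↔ a = 0) := by
  induction n with
  | zero => intro a ha; exact ⟨ha, Iff.rfl⟩
  | succ n ih =>
    intro a ha
    rw [Function.iterate_succ_apply']
    obtain ⟨h1, h2⟩ := ih a ha
    obtain ⟨h3, h4⟩ := scl_facts _ h1
    exact ⟨h3, h4.trans h2⟩

theorem scl_one : ∀ b < 8, b ≠ 0 → ∃ n < 7, scl^[n] b = 1 := by decide +kernel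

theorem window : ∀ f : Fin 7 → Bool, (∃ i, f i = true) →
    (f 0).toNat + (f 1).toNat + (f 2).toNat + (f 3).toNat + (f 4).toNat + (f 5).toNat +
      (f 6).toNat ≤ 3 → ∃ c : Fin 7, f c = true ∧ f (c + 5) = false ∧ f (c + 6) = false ∧
    ((f 0).toNat + (f 1).toNat + (f 2).toNat + (f 3).toNat + (f 4).toNat + (f 5).toNat +
      (f 6).toNat ≤ 2 → f (c + 4) = false) := by
  decide +kernel

theorem per_mod {α : Type} (v : ℕ → α) (hv : ∀ i, v (i + 7) = v i) (i : ℕ) : v (i % 7) = v i := by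
  induction i using Nat.strong_induction_on with
  | _ i ih =>
    by_cases h : i < 7
    · rw [Nat.mod_eq_of_lt h]
    · obtain ⟨m, rfl⟩ : ∃ m, i = m + 7 := ⟨i - 7, by omega⟩
      rw [Nat.add_mod_right, hv, ih m (by omega)]

theorem normalise (v : ℕ → ℕ) (hv : ∀ i, v (i + 7) = v i) (h8 : ∀ i, v i < 8) (k : ℕ) (hk : k < 4)
    (hw : wt v ≤ k) : ∃ c n, (X (fun i => scl^[n] (v (i + c))), wt v) ∈ nrmL k := by
  by_cases h0 : wt v = 0
  · refine ⟨0, 0, ?_⟩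
    have : X (fun i => scl^[0] (v (i + 0))) = 0 := cnt_zero h0
    rw [this, h0]
    rcases k with _ | k
    · exact List.mem_singleton.mpr rfl
    · exact List.mem_cons_self
  · let f : Fin 7 → Bool := fun i => decide (v i ≠ 0)
    have hf : ∀ i : Fin 7, (f i).toNat = if v i = 0 then 0 else 1 := by
      intro i; by_cases h : v i = 0 <;> simp [f, h]
    have hsum : (f 0).toNat + (f 1).toNat + (f 2).toNat + (f 3).toNat + (f 4).toNat + (f 5).toNat +
        (f 6).toNat = wt v := by
      simp only [hf, wt, cnt]
      simp only [Fin.val_zero, Fin.val_one, Fin.val_two, show ((3 : Fin 7) : ℕ) = 3 from rfl,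
        show ((4 : Fin 7) : ℕ) = 4 from rfl, show ((5 : Fin 7) : ℕ) = 5 from rfl,
        show ((6 : Fin 7) : ℕ) = 6 from rfl]
      omega
    have hex : ∃ i, f i = true := by
      by_contra hcon
      push Not at hcon
      apply h0
      rw [← hsum]
      simp [hcon]
    obtain ⟨c, c1, c2, c3, c4⟩ := window f hex (by rw [hsum]; omega)
    rw [hsum] at c4
    have hz : ∀ d : Fin 7, f (c + d) = false → v (d + c) = 0 := by
      intro d hd
      have : v ((c + d : Fin 7) : ℕ) = 0 := by simpa [f] using hd
      rwa [Fin.val_add, per_mod v hv, add_comm] at this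
    have z5 : v (5 + c) = 0 := hz 5 c2
    have z6 : v (6 + c) = 0 := hz 6 c3
    have z4 : wt v ≤ 2 → v (4 + c) = 0 := fun h => hz 4 (c4 h)
    have hc : v (0 + c) ≠ 0 := by
      have : v c ≠ 0 := by simpa [f] using c1
      rwa [zero_add]
    obtain ⟨n, -, hn⟩ := scl_one _ (h8 _) hc
    refine ⟨c, n, ?_⟩
    have sz : scl^[n] 0 = 0 := (scls_facts n 0 (by norm_num)).2.mpr rfl
    obtain ⟨v', hv'⟩ : ∃ v' : ℕ → ℕ, v' = fun i => scl^[n] (v (i + c)) := ⟨_, rfl⟩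
    have h8' : ∀ i, v' i < 8 := fun i => by rw [hv']; exact (scls_facts n _ (h8 _)).1
    have hwt : wt v = wt v' := by
      rw [← wt_shift v hv c, hv']
      exact cnt_congr (fun i _ => (scls_facts n _ (h8 _)).2.symm)
    have y0 : v' 0 = 1 := by rw [hv']; exact hn
    have y5 : v' 5 = 0 := by rw [hv']; simp only [z5, sz]
    have y6 : v' 6 = 0 := by rw [hv']; simp only [z6, sz]
    have y4 : wt v ≤ 2 → v' 4 = 0 := fun h => by rw [hv']; simp only [z4 h, sz]
    rw [← hv', hwt]
    rw [hwt] at hw y4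
    obtain ⟨b, rfl⟩ : ∃ b, k = b + 1 := ⟨k - 1, by omega⟩
    refine List.mem_cons_of_mem _ (List.mem_map.mpr ?_)
    by_cases hb : b = 2
    · have e2 : wt v' = cnt v' [1, 2, 3, 4] + 1 := by
        simp only [wt, cnt, y0, y5, y6]; simp; omega
      have e1 : X v' = lin (basisR 0) 1 ^^^ Xl v' [1, 2, 3, 4] := by
        simp only [X, Xl, y0, y5, y6, lin_zero, Nat.xor_zero]
      refine ⟨(Xl v' [1, 2, 3, 4], cnt v' [1, 2, 3, 4]), ?_, ?_⟩
      · rw [if_pos hb]; exact ws_mem v' h8' _ _ (by omega)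
      · rw [e1, e2]; rfl
    · have y4' := y4 (by omega)
      have e2 : wt v' = cnt v' [1, 2, 3] + 1 := by
        simp only [wt, cnt, y0, y4', y5, y6]; simp; omega
      have e1 : X v' = lin (basisR 0) 1 ^^^ Xl v' [1, 2, 3] := by
        simp only [X, Xl, y0, y4', y5, y6, lin_zero, Nat.xor_zero]
      refine ⟨(Xl v' [1, 2, 3], cnt v' [1, 2, 3]), ?_, ?_⟩
      · rw [if_neg hb]; exact ws_mem v' h8' _ _ (by omega)
      · rw [e1, e2]; rfl

theorem main_comb {u : ℕ → ℕ → ℕ} (hu : Code u)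
    (hw : wt (u 0) + wt (u 1) + wt (u 2) + wt (u 3) + wt (u 4) + wt (u 5) + wt (u 6) ≤ 15) :
    wt (u 0) + wt (u 1) + wt (u 2) + wt (u 3) + wt (u 4) + wt (u 5) + wt (u 6) = 0 := by
  obtain ⟨I, hI, r, b0, b1, b2, b3, b4⟩ := coverage2 (fun j => wt (u j)) hw
  have hper : ∀ j, u (j + 7) = u j := fun j => funext fun i => hu.perJ j i
  simp only [per_mod u hper] at b0 b1 b2 b3 b4
  have hu1 := hu.shiftJ r
  obtain ⟨c, n, hcn⟩ := normalise (u (I.p0 + r)) (fun i => hu.perI _ i) (fun i => hu.lt _ i) I.k0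
    (kinds_all I hI).1 b0
  have hu2 := (hu1.shiftI c).scales n
  obtain ⟨u2, hu2e⟩ : ∃ u2 : ℕ → ℕ → ℕ, u2 = fun j i => scl^[n] (u (j + r) (i + c)) := ⟨_, rfl⟩
  rw [← hu2e] at hu2
  have hwt : ∀ j, wt (u2 j) = wt (u (j + r)) := by
    intro j
    rw [← wt_shift (u (j + r)) (fun i => hu.perI _ i) c, hu2e]
    exact cnt_congr (fun i _ => (scls_facts n _ (hu.lt _ _)).2)
  have hx0 : (X (u2 I.p0), wt (u2 I.p0)) ∈ nrmL I.k0 := by rw [hwt, hu2e]; exact hcn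
  have hmem : ∀ p k, (k = 4 ∨ wt (u (p + r)) ≤ k) → Mem k (X (u2 p)) (wt (u2 p)) := by
    intro p k h
    exact ⟨u2 p, fun i => hu2.lt _ _, rfl, rfl, by rw [hwt]; exact h⟩
  obtain ⟨r1, r2, r3, r4, r5, r6⟩ := hu2.res hI
  have hs := soundAll I hI _ _ _ _ _ _ _ _ _ _ hx0 (hmem _ _ b1) (hmem _ _ b2) (hmem _ _ b3)
    (hmem _ _ b4) r1 r2 r3 r4
  have hfin := finalOK_sound hs (fun i => hu2.lt I.p5 i) (fun i => hu2.lt I.p6 i) r5 r6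
  have hperm := (perm_all I hI).map (fun p => wt (u2 p))
  have hsum := hperm.sum_eq
  simp only [List.map_cons, List.map_nil, List.sum_cons, List.sum_nil] at hsum
  have hrot := sum_rot (fun j => wt (u j)) (fun i => by simp only [hper]) r
  simp only [← hwt] at hrot
  omega

/-! ### The field with eight elements -/

theorem exists_omega : ∃ ω : F8, ω ^ 3 = ω + 1 := by
  classical
  have : Fintype F8 := Fintype.ofFinite F8
  have hcard : Fintype.card F8 = 8 := by
    rw [← Nat.card_eq_fintype_card, GaloisField.card 2 3 (by norm_num)]; norm_num
  have two : (2 : F8) = 0 := CharP.cast_eq_zero F8 2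
  obtain ⟨z, hz⟩ : ∃ z : F8, z ∉ ({0, 1} : Finset F8) := by
    by_contra hcon
    push Not at hcon
    have h1 : (Finset.univ : Finset F8) ⊆ {0, 1} := fun x _ => hcon x
    have h2 := Finset.card_le_card h1
    rw [Finset.card_univ, hcard] at h2
    have h3 := Finset.card_le_two (a := (0 : F8)) (b := 1)
    omega
  simp only [Finset.mem_insert, Finset.mem_singleton, not_or] at hz
  obtain ⟨z0, z1⟩ := hz
  have h8 : z ^ 8 = z := by
    have := FiniteField.pow_card z
    rwa [hcard] at this
  have hp : z * (z - 1) * ((z ^ 3 + z + 1) * (z ^ 3 + z ^ 2 + 1)) = 0 := by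
    linear_combination h8 + (z ^ 5 - z ^ 4) * two
  have hp2 : (z ^ 3 + z + 1) * (z ^ 3 + z ^ 2 + 1) = 0 := by
    rcases mul_eq_zero.mp hp with h | h
    · rcases mul_eq_zero.mp h with h | h
      · exact absurd h z0
      · exact absurd (sub_eq_zero.mp h) z1
    · exact h
  rcases mul_eq_zero.mp hp2 with h | h
  · exact ⟨z, by linear_combination h - (z + 1) * two⟩
  · refine ⟨z⁻¹, ?_⟩
    field_simp
    linear_combination (-1 : F8) * h + (1 : F8) * two

section Link

variable {ω : F8}

/-- decoding of `{0, …, 7}` -/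
noncomputable def phi (ω : F8) (a : ℕ) : F8 :=
  (if a.testBit 0 then 1 else 0) + (if a.testBit 1 then ω else 0) + (if a.testBit 2 then ω ^ 2 else 0)

theorem two_eq : (2 : F8) = 0 := CharP.cast_eq_zero F8 2

theorem phi_zero : phi ω 0 = 0 := by simp [phi]

theorem phi_xor (a b : ℕ) : phi ω (a ^^^ b) = phi ω a + phi ω b := by
  have key : ∀ (p q : Bool) (x : F8), (if (p ^^ q) = true then x else 0) =
      (if p = true then x else 0) + (if q = true then x else 0) := by
    intro p q x
    cases p <;> cases q <;> simp
    linear_combination (-x) * two_eq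
  simp only [phi, Nat.testBit_xor, key]
  ring

theorem omega_seven (hω : ω ^ 3 = ω + 1) : ω ^ 7 = 1 := by
  linear_combination (ω ^ 4 + ω ^ 2 + ω + 1) * hω + (ω ^ 2 + ω) * two_eq

theorem phi_ex (hω : ω ^ 3 = ω + 1) (n : ℕ) : phi ω (ex n) = ω ^ n := by
  have h7 := omega_seven hω
  have hn : ω ^ n = ω ^ (n % 7) := by
    conv_lhs => rw [← Nat.mod_add_div n 7]
    rw [pow_add, pow_mul, h7, one_pow, mul_one]
  rw [hn, ← ex_mod]
  have h : n % 7 < 7 := Nat.mod_lt _ (by norm_num)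
  generalize n % 7 = m at h
  interval_cases m
  · simp [phi, ex, Nat.testBit]
  · simp [phi, ex, Nat.testBit]
  · simp [phi, ex, Nat.testBit]
  · simp [phi, ex, Nat.testBit]; linear_combination -hω
  · simp [phi, ex, Nat.testBit]; linear_combination -ω * hω
  · simp [phi, ex, Nat.testBit]; linear_combination (-ω ^ 2 - 1) * hω
  · simp [phi, ex, Nat.testBit]; linear_combination (-ω ^ 3 - ω - 1) * hω - (ω ^ 1) * two_eq

theorem omega_ne (hω : ω ^ 3 = ω + 1) : ω ≠ 0 := by
  rintro rfl
  simp at hω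

theorem ex_surj : ∀ a < 8, a ≠ 0 → ∃ n < 7, a = ex n := by decide

theorem phi_eq_zero (hω : ω ^ 3 = ω + 1) {a : ℕ} (ha : a < 8) : phi ω a = 0 ↔ a = 0 := by
  constructor
  · intro h
    by_contra h0
    obtain ⟨n, -, rfl⟩ := ex_surj a ha h0
    rw [phi_ex hω] at h
    exact pow_ne_zero n (omega_ne hω) h
  · rintro rfl; exact phi_zero

theorem phi_scl (hω : ω ^ 3 = ω + 1) {a : ℕ} (ha : a < 8) : phi ω (scl a) = ω * phi ω a := by
  by_cases h0 : a = 0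
  · subst h0
    rw [show scl 0 = 0 from lin_zero _, phi_zero, mul_zero]
  · obtain ⟨n, -, rfl⟩ := ex_surj a ha h0
    rw [scl_ex, phi_ex hω, phi_ex hω, pow_succ, mul_comm]

theorem phi_scls (hω : ω ^ 3 = ω + 1) {a : ℕ} (ha : a < 8) (n : ℕ) :
    phi ω (scl^[n] a) = ω ^ n * phi ω a := by
  induction n with
  | zero => simp
  | succ n ih =>
    rw [Function.iterate_succ_apply', phi_scl hω (scls_facts n a ha).1, ih]; ring

/-- `ω` as a unit -/
noncomputable def om (hω : ω ^ 3 = ω + 1) : F8ˣ := Units.mk0 ω (omega_ne hω)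

theorem om_val (hω : ω ^ 3 = ω + 1) : ((om hω : F8ˣ) : F8) = ω := rfl

theorem om_order (hω : ω ^ 3 = ω + 1) : orderOf (om hω) = 7 := by
  have : Fact (Nat.Prime 7) := ⟨by norm_num⟩
  apply orderOf_eq_prime
  · ext; simpa [om_val] using omega_seven hω
  · intro h
    have : ω = 1 := by
      have := congrArg (fun x : F8ˣ => (x : F8)) h
      simpa [om_val] using this
    rw [this] at hω
    have h0 : (1 : F8) = 0 := by linear_combination (-1 : F8) * hω
    exact one_ne_zero h0

/-- the points -/
noncomputable def pt (hω : ω ^ 3 = ω + 1) (q : Fin 7 × Fin 7) : F8ˣ × F8ˣ :=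
  (om hω ^ ((q.1 : ℕ) + 4 * (q.2 : ℕ)), om hω ^ (q.2 : ℕ))

theorem pt_bij (hω : ω ^ 3 = ω + 1) : Function.Bijective (pt hω) := by
  have hinj : Function.Injective (pt hω) := by
    rintro ⟨j, i⟩ ⟨j', i'⟩ h
    simp only [pt, Prod.mk.injEq, pow_inj_mod, om_order] at h
    obtain ⟨h1, h2⟩ := h
    have e : i = i' := by ext; omega
    have e' : j = j' := by ext; omega
    rw [e, e']
  have : Fintype F8 := Fintype.ofFinite F8
  classical
  rw [Fintype.bijective_iff_injective_and_card]
  refine ⟨hinj, ?_⟩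
  have hcard : Fintype.card F8 = 8 := by
    rw [← Nat.card_eq_fintype_card, GaloisField.card 2 3 (by norm_num)]; norm_num
  rw [Fintype.card_prod, Fintype.card_prod, Fintype.card_units, hcard, Fintype.card_fin]

/-- `u` represents the codeword `c` -/
def RepW (hω : ω ^ 3 = ω + 1) (c : F8ˣ × F8ˣ → F8) (u : ℕ → ℕ → ℕ) : Prop :=
  ∀ j i : ℕ, c (om hω ^ (j + 4 * i), om hω ^ i) = phi ω (u j i)

theorem rep_gen (hω : ω ^ 3 = ω + 1) (s : ℕ × ℕ) (t : ℕ) :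
    RepW hω (ω ^ t • evalVec s) (gen s t) := by
  intro j i
  rw [gen, phi_ex hω]
  simp only [Pi.smul_apply, evalVec, smul_eq_mul, Units.val_pow_eq_pow_val, om_val]
  ring

theorem mem_S (s : ℕ × ℕ) : s ∈ S ↔ s ∈ SL := by
  simp only [S, SL, Set.mem_insert_iff, Set.mem_singleton_iff, List.mem_cons, List.not_mem_nil,
    or_false]

theorem field_cases (hω : ω ^ 3 = ω + 1) (a : F8) : a = 0 ∨ ∃ n : ℕ, a = ω ^ n := by
  by_cases h : a = 0
  · exact Or.inl h
  · right
    obtain ⟨q, hq⟩ := (pt_bij hω).2 (1, Units.mk0 a h)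
    refine ⟨q.2, ?_⟩
    have := congrArg (fun x : F8ˣ × F8ˣ => ((x.2 : F8ˣ) : F8)) hq
    simpa [pt, om_val] using this.symm

theorem exists_rep (hω : ω ^ 3 = ω + 1) (c : F8ˣ × F8ˣ → F8)
    (hc : c ∈ Submodule.span F8 (evalVec '' S)) : ∃ u, Code u ∧ RepW hω c u := by
  induction hc using Submodule.span_induction with
  | mem x hx =>
    obtain ⟨s, hs, rfl⟩ := hx
    refine ⟨gen s 0, Code.gen s ((mem_S s).mp hs) 0, ?_⟩
    have := rep_gen hω s 0
    rwa [pow_zero, one_smul] at this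
  | zero => exact ⟨_, Code.zero, fun j i => by rw [phi_zero]; rfl⟩
  | add x y _ _ hx hy =>
    obtain ⟨u, hu, ru⟩ := hx
    obtain ⟨v, hv, rv⟩ := hy
    exact ⟨_, Code.add hu hv, fun j i => by rw [phi_xor, ← ru, ← rv]; rfl⟩
  | smul a x _ hx =>
    obtain ⟨u, hu, ru⟩ := hx
    rcases field_cases hω a with rfl | ⟨n, rfl⟩
    · exact ⟨_, Code.zero, fun j i => by rw [phi_zero]; simp⟩
    · exact ⟨_, hu.scales n, fun j i => by rw [phi_scls hω (hu.lt _ _), ← ru]; rfl⟩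

theorem exists_word (hω : ω ^ 3 = ω + 1) {u : ℕ → ℕ → ℕ} (hu : Code u) :
    ∃ c ∈ Submodule.span F8 (evalVec '' S), RepW hω c u := by
  induction hu with
  | zero => exact ⟨0, Submodule.zero_mem _, fun j i => by rw [phi_zero]; rfl⟩
  | gen s hs t =>
    exact ⟨ω ^ t • evalVec s, Submodule.smul_mem _ _ (Submodule.subset_span
      ⟨s, (mem_S s).mpr hs, rfl⟩), rep_gen hω s t⟩
  | add hu hv h1 h2 =>
    obtain ⟨c, hc, rc⟩ := h1
    obtain ⟨d, hd, rd⟩ := h2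
    exact ⟨c + d, Submodule.add_mem _ hc hd, fun j i => by rw [phi_xor, ← rc, ← rd]; rfl⟩

theorem weight_rep (hω : ω ^ 3 = ω + 1) {c : F8ˣ × F8ˣ → F8} {u : ℕ → ℕ → ℕ} (hu : Code u)
    (h : RepW hω c u) : hammingWeight c =
      wt (u 0) + wt (u 1) + wt (u 2) + wt (u 3) + wt (u 4) + wt (u 5) + wt (u 6) := by
  classical
  have e1 : hammingWeight c = Nat.card {q : Fin 7 × Fin 7 // u q.1 q.2 ≠ 0} := by
    symm
    refine Nat.card_congr ((Equiv.ofBijective _ (pt_bij hω)).subtypeEquiv ?_)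
    intro q
    have := h q.1 q.2
    rw [Equiv.ofBijective_apply, pt, this, Ne, Ne, phi_eq_zero hω (hu.lt _ _)]
  rw [e1, Nat.card_eq_fintype_card, Fintype.card_subtype, Finset.card_filter,
    Fintype.sum_prod_type]
  simp only [Fin.sum_univ_seven, wt, cnt]
  have key : ∀ a : ℕ, (if a ≠ 0 then 1 else 0) = if a = 0 then 0 else 1 := by
    intro a; by_cases h : a = 0 <;> simp [h]
  simp only [key, add_zero, ← add_assoc]
  rfl

end Link

/-! ### A codeword of weight 16 -/

/-- monomials of a codeword of weight 16, with the logarithms of their coefficients -/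
def list16 : List ((ℕ × ℕ) × ℕ) := [((0, 4), 6), ((0, 5), 0), ((0, 6), 4), ((1, 2), 1), ((1, 3), 6),
  ((1, 4), 4), ((1, 5), 6), ((1, 6), 6), ((2, 1), 3), ((2, 2), 0), ((2, 3), 3), ((2, 6), 4),
  ((3, 0), 2), ((3, 2), 6), ((3, 4), 5), ((3, 6), 2), ((4, 2), 1), ((4, 3), 3), ((4, 5), 4),
  ((5, 5), 2), ((6, 2), 5), ((6, 3), 3)]

/-- sum of encoded monomials -/
def sumGen : List ((ℕ × ℕ) × ℕ) → ℕ → ℕ → ℕ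
  | [] => fun _ _ => 0
  | p :: l => fun j i => gen p.1 p.2 j i ^^^ sumGen l j i

theorem sumGen_code (l : List ((ℕ × ℕ) × ℕ)) (h : ∀ p ∈ l, p.1 ∈ SL) : Code (sumGen l) := by
  induction l with
  | nil => exact Code.zero
  | cons p l ih =>
    exact Code.add (Code.gen p.1 (h p (by simp)) p.2) (ih fun q hq => h q (by simp [hq]))

theorem weight16 : wt (sumGen list16 0) + wt (sumGen list16 1) + wt (sumGen list16 2) +
    wt (sumGen list16 3) + wt (sumGen list16 4) + wt (sumGen list16 5) + wt (sumGen list16 6) = 16 := by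
  decide +kernel

theorem weight_zero (c : F8ˣ × F8ˣ → F8) (h : hammingWeight c = 0) : c = 0 := by
  have hfin : Finite {p : F8ˣ × F8ˣ // c p ≠ 0} := inferInstance
  rw [hammingWeight, Finite.card_eq_zero_iff] at h
  funext p
  by_contra hp
  exact h.false ⟨p, hp⟩

/-- The generalised toric code `C_S` over `F₈` has minimum distance exactly 16:
every nonzero codeword has Hamming weight at least 16, and some codeword has
Hamming weight exactly 16. -/
theorem min_dist :
    (∀ c ∈ Submodule.span F8 (evalVec '' S), c ≠ 0 → 16 ≤ hammingWeight c) ∧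
    (∃ c ∈ Submodule.span F8 (evalVec '' S), hammingWeight c = 16) := by
  obtain ⟨ω, hω⟩ := exists_omega
  constructor
  · intro c hc h0
    obtain ⟨u, hu, hr⟩ := exists_rep hω c hc
    have hw := weight_rep hω hu hr
    by_contra hlt
    exact h0 (weight_zero c (by rw [hw]; exact main_comb hu (by omega)))
  · have hu : Code (sumGen list16) := sumGen_code list16 (by decide)
    obtain ⟨c, hc, hr⟩ := exists_word hω hu
    exact ⟨c, hc, by rw [weight_rep hω hu hr, weight16]⟩
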